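/- arXiv:1001.2822 — 3 statements merged into one kernel-verified Lean document; each statement's English description precedes it below -/
import Mathlib

section
/- Let (R,m) be a Noetherian local ring and M a finite R-module of dimension d ≥ 2. Let J be a parameter ideal for M. If M/H^0_m(M) is Cohen–Macaulay, then e_1(J,M) = 0. -/
/-- `HasLength R M n` : the `R`-module `M` has finite length `n`. -/
def HasLength (R M : Type*) [Ring R] [AddCommGroup M] [Module R M] (n : ℕ) : Prop :=
  ∃ s : CompositionSeries (Submodule R M), s.head = ⊥ ∧ s.last = ⊤ ∧ s.length = n

/-- `M` is a Cohen–Macaulay module of dimension `n`: its dimension is `n` and (since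
`depth ≤ dim` always) it has an `M`-regular sequence of length `n` in the maximal ideal. -/
def IsCMofDim (R : Type*) [CommRing R] [IsLocalRing R] (M : Type*) [AddCommGroup M]
    [Module R M] (n : ℕ) : Prop :=
  ringKrullDim (R ⧸ Module.annihilator R M) = n ∧
    ∃ rs : List R, rs.length = n ∧ (∀ r ∈ rs, r ∈ IsLocalRing.maximalIdeal R) ∧
      RingTheory.Sequence.IsRegular M rs

namespace ChernAux
open IsLocalRing RingTheory.Sequence Module
open scoped Pointwise

universe u v

lemma supportDim_mono_of_support {R : Type*} [CommRing R] {M N : Type*} [AddCommGroup M] [Module R M]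
    [AddCommGroup N] [Module R N] (h : support R M ⊆ support R N) :
    supportDim R M ≤ supportDim R N :=
  Order.krullDim_le_of_strictMono (fun a ↦ ⟨a.1, h a.2⟩) (fun {_ _} lt ↦ lt)

lemma supportDim_le_length {R : Type*} [CommRing R] [IsNoetherianRing R] [IsLocalRing R]
    (xs : List R) : ∀ {K : Type v} [AddCommGroup K] [Module R K] [Module.Finite R K]
    (_ : ∀ x ∈ xs, x ∈ maximalIdeal R)
    (_ : ∀ q ∈ support R K, (∀ x ∈ xs, x ∈ q.asIdeal) → q = closedPoint R),
    supportDim R K ≤ xs.length := by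
  induction xs with
  | nil =>
    intro K _ _ _ _ h
    have : Subsingleton (support R K) :=
      ⟨fun a b => Subtype.ext ((h a a.2 (by simp)).trans (h b b.2 (by simp)).symm)⟩
    simpa [supportDim] using Order.krullDim_nonpos_of_subsingleton (α := support R K)
  | cons x xs ih =>
    intro K _ _ _ hm h
    refine (supportDim_le_supportDim_quotSMulTop_succ (hm x (by simp))).trans ?_
    have := ih (K := QuotSMulTop x K) (fun y hy => hm y (by simp [hy])) (by
      intro q hq hxs
      rw [support_quotSMulTop] at hq
      refine h q hq.1 ?_
      intro y hy
      rcases List.mem_cons.1 hy with rfl | hy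
      · simpa using hq.2
      · exact hxs y hy)
    rw [List.length_cons]
    push_cast
    gcongr

lemma le_supportDim_of_assoc {R : Type*} [CommRing R] [IsNoetherianRing R] [IsLocalRing R]
    (rs : List R) : ∀ {M : Type v} [AddCommGroup M] [Module R M] [Module.Finite R M]
    (_ : ∀ x ∈ rs, x ∈ maximalIdeal R) (_ : IsRegular M rs)
    (p : Ideal R) (_ : IsAssociatedPrime p M), (rs.length : WithBot ℕ∞) ≤ supportDim R (R ⧸ p) := by
  induction rs with
  | nil =>
    intro M _ _ _ _ _ p hp
    have := hp.isPrime
    have h0 : supportDim R (R ⧸ p) ≠ ⊥ := supportDim_ne_bot_of_nontrivial R (R ⧸ p)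
    have : Nonempty (support R (R ⧸ p)) := (nonempty_support_of_nontrivial).to_subtype
    simpa [supportDim] using Order.krullDim_nonneg (α := support R (R ⧸ p))
  | cons r rs ih =>
    intro M _ _ _ hm hreg p hp
    have hpp := hp.isPrime
    rw [isRegular_cons_iff] at hreg
    obtain ⟨hr, hrs⟩ := hreg
    obtain ⟨-, m, hmp⟩ := isAssociatedPrime_iff.1 hp
    have hmem : ∀ a, a ∈ p ↔ a • m = 0 := fun a => by
      rw [hmp, Submodule.mem_colon_singleton, Submodule.mem_bot]
    have hm0 : m ≠ 0 := by
      rintro rfl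
      exact hpp.ne_top ((Ideal.eq_top_iff_one _).2 ((hmem 1).2 (by simp)))
    have hrp : r ∉ p := fun h => hm0 (hr.right_eq_zero_of_smul ((hmem r).1 h))
    -- the p-torsion
    let L : Submodule R M := ⨅ a : p, Submodule.torsionBy R M a
    have hL : ∀ y, y ∈ L ↔ ∀ a ∈ p, a • y = 0 := by
      intro y; simp [L, Submodule.mem_iInf]
    have hmL : m ∈ L := (hL m).2 fun a ha => (hmem a).1 ha
    have : ∃ l ∈ L, l ∉ (r • ⊤ : Submodule R M) := by
      by_contra! hcon
      have hle : L ≤ maximalIdeal R • L := by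
        intro l hl
        obtain ⟨y, -, rfl⟩ := hcon l hl
        refine Submodule.smul_mem_smul (hm r (by simp)) ((hL y).2 fun a ha => ?_)
        have := (hL _).1 hl a ha
        apply hr.right_eq_zero_of_smul
        simpa [smul_comm a r] using this
      have := Submodule.eq_bot_of_le_smul_of_le_jacobson_bot (maximalIdeal R) L
        (IsNoetherian.noetherian L) hle (maximalIdeal_le_jacobson _)
      rw [this] at hmL
      exact hm0 (by simpa using hmL)
    obtain ⟨l, hlL, hl⟩ := this
    have hl0 : (Submodule.Quotient.mk l : QuotSMulTop r M) ≠ 0 := by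
      rwa [Ne, Submodule.Quotient.mk_eq_zero]
    obtain ⟨q, hq, hle⟩ := exists_le_isAssociatedPrime_of_isNoetherianRing R _ hl0
    have hpq : p ≤ q := fun a ha => hle (by
      rw [Submodule.mem_colon_singleton, Submodule.mem_bot, ← Submodule.Quotient.mk_smul,
        (hL l).1 hlL a ha]; rfl)
    have hrq : r ∈ q := hle (by
      rw [Submodule.mem_colon_singleton, Submodule.mem_bot, ← Submodule.Quotient.mk_smul,
        Submodule.Quotient.mk_eq_zero]
      exact Submodule.smul_mem_pointwise_smul _ _ _ trivial)
    have h1 := ih (fun x hx => hm x (by simp [hx])) hrs q hq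
    have hreg : IsSMulRegular (R ⧸ p) r := by
      refine IsSMulRegular.of_right_eq_zero_of_smul fun y hy => ?_
      obtain ⟨y, rfl⟩ := Ideal.Quotient.mk_surjective y
      rw [← Ideal.Quotient.mk_eq_mk, ← Submodule.Quotient.mk_smul, Ideal.Quotient.mk_eq_mk,
        Ideal.Quotient.eq_zero_iff_mem] at hy
      rw [Ideal.Quotient.eq_zero_iff_mem]
      exact (hpp.mem_or_mem hy).resolve_left hrp
    rw [← supportDim_quotSMulTop_succ_eq_supportDim hreg (hm r (by simp)), List.length_cons]
    push_cast
    gcongr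
    refine h1.trans (supportDim_mono_of_support ?_)
    intro P hP
    rw [support_quotSMulTop]
    rw [mem_support_iff_of_finite, Ideal.annihilator_quotient] at hP
    refine ⟨?_, by simpa using hP hrq⟩
    rw [mem_support_iff_of_finite, Ideal.annihilator_quotient]
    exact hpq.trans hP

open CategoryTheory Abelian in
lemma depth_quot {R : Type u} [CommRing R] [IsNoetherianRing R] [IsLocalRing R]
    {M : Type v} [AddCommGroup M] [Module R M] [Module.Finite R M]
    (rs : List R) (n : ℕ) (hlen : rs.length = n + 1) (hm : ∀ x ∈ rs, x ∈ maximalIdeal R)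
    (hreg : IsRegular M rs) (x : R) (hx : x ∈ maximalIdeal R) (hxreg : IsSMulRegular M x) :
    ∃ rs' : List R, rs'.length = n ∧ (∀ r ∈ rs', r ∈ maximalIdeal R) ∧
      IsRegular (QuotSMulTop x M) rs' := by
  let e : ULift.{u} M ≃ₗ[R] M := ULift.moduleEquiv
  have : Nontrivial M := hreg.nontrivial
  have hlt : ∀ (K : Type (max u v)) [AddCommGroup K] [Module R K] [Module.Finite R K]
    [Nontrivial K], maximalIdeal R • (⊤ : Submodule R K) < ⊤ := by
    intro K _ _ _ _
    exact (Submodule.top_ne_ideal_smul_of_le_jacobson_annihilator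
      (maximalIdeal_le_jacobson _)).symm.lt_top
  let N : ModuleCat.{max u v} R := ModuleCat.of R (ULift.{max u v} (R ⧸ maximalIdeal R))
  have hsupp : Module.support R N = PrimeSpectrum.zeroLocus (maximalIdeal R) := by
    have : Module.support R N = Module.support R (R ⧸ maximalIdeal R) :=
      (ULift.moduleEquiv (R := R)).support_eq
    rw [this, Module.support_eq_zeroLocus, Ideal.annihilator_quotient]
  have hfin : Module.Finite R N :=
    inferInstanceAs (Module.Finite R (ULift.{max u v} (R ⧸ maximalIdeal R)))
  have h_ext := ModuleCat.subsingleton_ext_of_exists_isRegular (maximalIdeal R) N hsupp.subset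
    (ModuleCat.of R (ULift.{u} M)) (hlt _) rs hm ((e.isRegular_congr rs).2 hreg)
  have hx' : IsSMulRegular (ULift.{u} M) x := (e.isSMulRegular_congr x).2 hxreg
  have : Nontrivial (QuotSMulTop x (ULift.{u} M)) := nontrivial_quotSMulTop_of_mem_maximalIdeal _ hx
  have h_ext' : ∀ i < n, Subsingleton (Ext N (ModuleCat.of R (QuotSMulTop x (ULift.{u} M))) i) := by
    intro i hi
    have zero1 := AddCommGrpCat.isZero_of_iff_subsingleton.mpr (h_ext i (by omega))
    have zero2 := AddCommGrpCat.isZero_of_iff_subsingleton.mpr (h_ext (i + 1) (by omega))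
    exact AddCommGrpCat.subsingleton_of_isZero <| ShortComplex.Exact.isZero_of_both_zeros
      ((Ext.covariant_sequence_exact₃' N
        (IsSMulRegular.smulShortComplex_shortExact (M := ModuleCat.of R (ULift.{u} M)) hx'))
        i (i + 1) rfl)
      (zero1.eq_zero_of_src _) (zero2.eq_zero_of_tgt _)
  obtain ⟨rs', h1, h2, h3⟩ := ModuleCat.exists_isRegular_of_exists_subsingleton_ext (maximalIdeal R) n
    (ModuleCat.of R (QuotSMulTop x (ULift.{u} M))) (hlt _) N hsupp h_ext'
  exact ⟨rs', h1, h2, ((QuotSMulTop.congr x e).isRegular_congr rs').1 h3⟩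

lemma isRegular_of_sop {R : Type u} [CommRing R] [IsNoetherianRing R] [IsLocalRing R]
    (xs : List R) : ∀ {M : Type v} [AddCommGroup M] [Module R M] [Module.Finite R M]
    (_ : ∀ x ∈ xs, x ∈ maximalIdeal R)
    (_ : ∃ rs : List R, rs.length = xs.length ∧ (∀ r ∈ rs, r ∈ maximalIdeal R) ∧ IsRegular M rs)
    (_ : ∀ q ∈ support R M, (∀ x ∈ xs, x ∈ q.asIdeal) → q = closedPoint R),
    IsWeaklyRegular M xs := by
  induction xs with
  | nil => intros; simp
  | cons x xs ih =>
    intro M _ _ _ hm ⟨rs, hlen, hrm, hreg⟩ hs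
    have hx : IsSMulRegular M x := by
      by_contra hx
      have : x ∈ ⋃ p ∈ associatedPrimes R M, (p : Set R) := by
        rw [biUnion_associatedPrimes_eq_compl_regular]; exact hx
      simp only [Set.mem_iUnion] at this
      obtain ⟨p, hp, hxp⟩ := this
      have h1 := le_supportDim_of_assoc rs hrm hreg p hp
      have h2 := supportDim_le_length (K := R ⧸ p) xs (fun y hy => hm y (by simp [hy])) (by
        intro q hq hxs
        rw [mem_support_iff_of_finite, Ideal.annihilator_quotient] at hq
        refine hs q ?_ ?_
        · rw [mem_support_iff_of_finite]
          have := hp.annihilator_le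
          rw [Submodule.annihilator_top] at this
          exact this.trans hq
        · intro y hy
          rcases List.mem_cons.1 hy with rfl | hy
          · exact hq hxp
          · exact hxs y hy)
      have h3 := h1.trans h2
      rw [hlen, List.length_cons] at h3
      have : xs.length + 1 ≤ xs.length := by exact_mod_cast h3
      omega
    rw [isWeaklyRegular_cons_iff]
    refine ⟨hx, ih (fun y hy => hm y (by simp [hy]))
      (depth_quot rs xs.length hlen hrm hreg x (hm x (by simp)) hx) ?_⟩
    intro q hq hxs
    rw [support_quotSMulTop] at hq
    refine hs q hq.1 ?_
    intro y hy
    rcases List.mem_cons.1 hy with rfl | hy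
    · simpa using hq.2
    · exact hxs y hy
end ChernAux

namespace ChernAux
open IsLocalRing RingTheory.Sequence Module
open scoped Pointwise

lemma sup_pow_succ {R : Type*} [CommRing R] (I J : Ideal R) (k : ℕ) :
    (I ⊔ J) ^ (k + 1) ≤ I * (I ⊔ J) ^ k ⊔ J ^ (k + 1) := by
  induction k with
  | zero => simp
  | succ k ih =>
    rw [pow_succ' (I ⊔ J) (k + 1), Ideal.sup_mul]
    refine sup_le le_sup_left ?_
    refine (Ideal.mul_mono_right ih).trans ?_
    rw [Ideal.mul_sup]
    refine sup_le (le_sup_of_le_left ?_) (le_sup_of_le_right (by rw [← pow_succ']))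
    rw [mul_left_comm]
    refine Ideal.mul_mono_right ?_
    rw [pow_succ' (I ⊔ J) k]
    exact Ideal.mul_mono_left le_sup_right

lemma exact_seq {R : Type*} [CommRing R] {M : Type*} [AddCommGroup M] [Module R M]
    (x : R) (J' J : Ideal R) (hJ : J = Ideal.span {x} ⊔ J') (hx : IsSMulRegular M x) (k : ℕ)
    (hxk : IsSMulRegular (M ⧸ (J' ^ (k + 1) • ⊤ : Submodule R M)) x) :
    ∃ (f : (M ⧸ (J ^ k • ⊤ : Submodule R M)) →ₗ[R] (M ⧸ (J ^ (k + 1) • ⊤ : Submodule R M)))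
      (g : (M ⧸ (J ^ (k + 1) • ⊤ : Submodule R M)) →ₗ[R]
        (QuotSMulTop x M ⧸ (J' ^ (k + 1) • ⊤ : Submodule R (QuotSMulTop x M)))),
      Function.Injective f ∧ Function.Surjective g ∧ Function.Exact f g := by
  have hxJ : x ∈ J := hJ ▸ (le_sup_left : _ ≤ _ ⊔ J') (Ideal.mem_span_singleton_self x)
  have hJ'J : J' ≤ J := hJ ▸ le_sup_right
  have key : ∀ m ∈ (J ^ (k + 1) • ⊤ : Submodule R M), ∃ j ∈ (J ^ k • ⊤ : Submodule R M),
      ∃ l ∈ (J' ^ (k + 1) • ⊤ : Submodule R M), m = x • j + l := by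
    intro m hm
    have := Submodule.smul_mono_left (N := (⊤ : Submodule R M))
      (by subst hJ; exact sup_pow_succ (Ideal.span {x}) J' k : J ^ (k + 1) ≤ Ideal.span {x} * J ^ k ⊔ J' ^ (k + 1)) hm
    rw [Submodule.sup_smul, Submodule.mul_smul, Submodule.ideal_span_singleton_smul] at this
    obtain ⟨a, ha, l, hl, rfl⟩ := Submodule.mem_sup.1 this
    obtain ⟨j, hj, rfl⟩ := ha
    exact ⟨j, hj, l, hl, rfl⟩
  have mapJ : Submodule.map (Submodule.mkQ (x • ⊤ : Submodule R M)) (J' ^ (k + 1) • ⊤) =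
      (J' ^ (k + 1) • ⊤ : Submodule R (QuotSMulTop x M)) := by
    rw [Submodule.map_smul'', Submodule.map_top, Submodule.range_mkQ]
  let f := Submodule.mapQ (J ^ k • ⊤ : Submodule R M) (J ^ (k + 1) • ⊤ : Submodule R M)
    (LinearMap.lsmul R M x) (by
      intro m hm
      rw [pow_succ', Submodule.mul_smul]
      exact Submodule.smul_mem_smul hxJ hm)
  let g := Submodule.mapQ (J ^ (k + 1) • ⊤ : Submodule R M)
    (J' ^ (k + 1) • ⊤ : Submodule R (QuotSMulTop x M)) (Submodule.mkQ (x • ⊤ : Submodule R M)) (by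
      intro m hm
      obtain ⟨j, hj, l, hl, rfl⟩ := key m hm
      rw [Submodule.mem_comap, map_add]
      have h0 : Submodule.mkQ (x • ⊤ : Submodule R M) (x • j) = 0 := by
        rw [Submodule.mkQ_apply, Submodule.Quotient.mk_eq_zero]
        exact Submodule.smul_mem_pointwise_smul _ _ _ trivial
      rw [h0, zero_add, ← mapJ]
      exact Submodule.mem_map_of_mem hl)
  refine ⟨f, g, ?_, ?_, ?_⟩
  · rw [injective_iff_map_eq_zero]
    intro a ha
    obtain ⟨m, rfl⟩ := Submodule.Quotient.mk_surjective _ a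
    have hm : x • m ∈ (J ^ (k + 1) • ⊤ : Submodule R M) := by
      rw [← Submodule.Quotient.mk_eq_zero]; exact ha
    rw [Submodule.Quotient.mk_eq_zero]
    obtain ⟨j, hj, l, hl, h⟩ := key _ hm
    have h2 : x • (m - j) ∈ (J' ^ (k + 1) • ⊤ : Submodule R M) := by
      rw [smul_sub, h]; simpa using hl
    have h3 := mem_of_isSMulRegular_quotient_of_smul_mem hxk h2
    have h4 : m - j ∈ (J ^ k • ⊤ : Submodule R M) :=
      Submodule.smul_mono_left ((Ideal.pow_right_mono hJ'J _).trans (Ideal.pow_le_pow_right (by omega))) h3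
    simpa using add_mem h4 hj
  · intro b
    obtain ⟨b, rfl⟩ := Submodule.Quotient.mk_surjective _ b
    obtain ⟨m, rfl⟩ := Submodule.Quotient.mk_surjective _ b
    exact ⟨Submodule.Quotient.mk m, rfl⟩
  · intro b
    obtain ⟨m, rfl⟩ := Submodule.Quotient.mk_surjective _ b
    constructor
    · intro h
      have h1 : Submodule.mkQ (x • ⊤ : Submodule R M) m ∈
          (J' ^ (k + 1) • ⊤ : Submodule R (QuotSMulTop x M)) := by
        rw [← Submodule.Quotient.mk_eq_zero]; exact h
      rw [← mapJ] at h1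
      obtain ⟨l, hl, hlm⟩ := h1
      rw [Submodule.mkQ_apply, Submodule.mkQ_apply, eq_comm, Submodule.Quotient.eq] at hlm
      obtain ⟨y, -, hy⟩ := hlm
      refine ⟨Submodule.Quotient.mk y, ?_⟩
      change Submodule.Quotient.mk (x • y) = _
      rw [Submodule.Quotient.eq]
      have hy' : x • y = m - l := hy
      rw [hy']
      have : m - l - m = -l := by abel
      rw [this]
      exact neg_mem (Submodule.smul_mono_left (Ideal.pow_right_mono hJ'J _) hl)
    · rintro ⟨a, ha⟩
      obtain ⟨y, rfl⟩ := Submodule.Quotient.mk_surjective _ a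
      rw [← ha]
      change Submodule.Quotient.mk (Submodule.mkQ (x • ⊤ : Submodule R M) (x • y)) = _
      have h0 : Submodule.mkQ (x • ⊤ : Submodule R M) (x • y) = 0 := by
        rw [Submodule.mkQ_apply, Submodule.Quotient.mk_eq_zero]
        exact Submodule.smul_mem_pointwise_smul _ _ _ trivial
      rw [h0]; rfl

universe u v

lemma regular_pow {R : Type u} [CommRing R] [IsNoetherianRing R] [IsLocalRing R]
    (L : List R) : ∀ {M : Type v} [AddCommGroup M] [Module R M] [Module.Finite R M] (y : R)
    (_ : ∀ r ∈ L ++ [y], r ∈ maximalIdeal R) (_ : IsWeaklyRegular M (L ++ [y])) (k : ℕ),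
    IsSMulRegular (M ⧸ (Ideal.ofList L ^ k • ⊤ : Submodule R M)) y := by
  induction L with
  | nil =>
    intro M _ _ _ y _ h k
    rw [List.nil_append, isWeaklyRegular_singleton_iff] at h
    rw [isSMulRegular_quotient_iff_mem_of_smul_mem]
    intro m hm
    cases k with
    | zero => simp
    | succ k =>
      have h0 : (Ideal.ofList ([] : List R) ^ (k + 1) • ⊤ : Submodule R M) = ⊥ := by
        rw [Ideal.ofList_nil, ← Ideal.zero_eq_bot, zero_pow (by omega), Ideal.zero_eq_bot,
          Submodule.bot_smul]
      rw [h0, Submodule.mem_bot] at hm ⊢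
      exact h.right_eq_zero_of_smul hm
  | cons x L ih =>
    intro M _ _ _ y hm h k
    have h2 : IsWeaklyRegular M ((L ++ [x]) ++ [y]) := by
      refine isWeaklyRegular_of_perm_of_subset_maximalIdeal h ?_ hm
      exact List.Perm.append_right _ (List.perm_append_singleton x L).symm
    have h3 : IsWeaklyRegular M (L ++ [x]) := ((isWeaklyRegular_append_iff M _ _).1 h2).1
    rw [List.cons_append, isWeaklyRegular_cons_iff] at h
    have hxk := ih (M := M) x (fun r hr => hm r (by
      simp only [List.mem_append, List.mem_singleton, List.mem_cons] at hr ⊢; tauto)) h3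
    have hyk := ih (M := QuotSMulTop x M) y (fun r hr => hm r (by
      simp only [List.mem_append, List.mem_singleton, List.mem_cons] at hr ⊢; tauto)) h.2
    induction k with
    | zero =>
      rw [isSMulRegular_quotient_iff_mem_of_smul_mem]
      simp
    | succ k ihk =>
      obtain ⟨f, g, hf, hg, hfg⟩ := exact_seq x (Ideal.ofList L) (Ideal.ofList (x :: L))
        (Ideal.ofList_cons x L) h.1 k (hxk _)
      exact isSMulRegular_of_range_eq_ker hf (LinearMap.exact_iff.1 hfg).symm ihk (hyk _)

lemma length_pow {R : Type u} [CommRing R] [IsNoetherianRing R] [IsLocalRing R]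
    (L : List R) : ∀ {M : Type v} [AddCommGroup M] [Module R M] [Module.Finite R M]
    (_ : ∀ r ∈ L, r ∈ maximalIdeal R) (_ : IsWeaklyRegular M L) (n : ℕ),
    Module.length R (M ⧸ (Ideal.ofList L ^ (n + 1) • ⊤ : Submodule R M)) =
      ((n + L.length).choose L.length : ℕ) *
        Module.length R (M ⧸ (Ideal.ofList L • ⊤ : Submodule R M)) := by
  induction L with
  | nil =>
    intro M _ _ _ _ _ n
    have h0 : Ideal.ofList ([] : List R) ^ (n + 1) = Ideal.ofList ([] : List R) := by
      rw [Ideal.ofList_nil, ← Ideal.zero_eq_bot, zero_pow (by omega)]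
    rw [h0]; simp
  | cons x L ih =>
    intro M _ _ _ hm h n
    have h3 : IsWeaklyRegular M (L ++ [x]) :=
      isWeaklyRegular_of_perm_of_subset_maximalIdeal h (List.perm_append_singleton x L).symm hm
    have hxk := regular_pow (M := M) L x (fun r hr => hm r (by
      simp only [List.mem_append, List.mem_singleton, List.mem_cons] at hr ⊢; tauto)) h3
    rw [isWeaklyRegular_cons_iff] at h
    have ih' := ih (M := QuotSMulTop x M) (fun r hr => hm r (by simp [hr])) h.2
    have hc : Module.length R (QuotSMulTop x M ⧸ (Ideal.ofList L • ⊤ : Submodule R (QuotSMulTop x M)))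
        = Module.length R (M ⧸ (Ideal.ofList (x :: L) • ⊤ : Submodule R M)) :=
      (Submodule.quotOfListConsSMulTopEquivQuotSMulTopInner M x L).symm.length_eq
    induction n with
    | zero => rw [zero_add, zero_add, pow_one]; simp
    | succ n ihn =>
      obtain ⟨f, g, hf, hg, hfg⟩ := exact_seq x (Ideal.ofList L) (Ideal.ofList (x :: L))
        (Ideal.ofList_cons x L) h.1 (n + 1) (hxk _)
      rw [Module.length_eq_add_of_exact f g hf hg hfg, ihn, ih', hc, ← add_mul]
      congr 1
      rw [List.length_cons, ← Nat.cast_add]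
      congr 1
      rw [show n + 1 + (L.length + 1) = (n + 1 + L.length) + 1 by ring, Nat.choose_succ_succ,
        add_comm, show n + (L.length + 1) = n + 1 + L.length by ring]

lemma binom_indep (D : ℕ) : ∀ (a : ℕ → ℤ) (c : ℤ) (n0 : ℕ)
    (_ : ∀ n ≥ n0, ∑ j ∈ Finset.range (D + 1), a j * ((n + j).choose j : ℤ) = c),
    ∀ j, 1 ≤ j → j ≤ D → a j = 0 := by
  induction D with
  | zero => intros; omega
  | succ D ih =>
    intro a c n0 h
    have hdiff : ∀ n ≥ n0 + 1, ∑ j ∈ Finset.range (D + 1), a (j + 1) * ((n + j).choose j : ℤ) = 0 := by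
      intro n hn
      obtain ⟨n, rfl⟩ : ∃ k, n = k + 1 := ⟨n - 1, by omega⟩
      have h1 := h (n + 1) (by omega)
      have h2 := h n (by omega)
      rw [Finset.sum_range_succ'] at h1 h2
      have h3 : ∑ j ∈ Finset.range (D + 1), a (j + 1) * ((n + 1 + (j + 1)).choose (j + 1) : ℤ) =
          ∑ j ∈ Finset.range (D + 1), a (j + 1) * ((n + (j + 1)).choose (j + 1) : ℤ) +
          ∑ j ∈ Finset.range (D + 1), a (j + 1) * ((n + 1 + j).choose j : ℤ) := by
        rw [← Finset.sum_add_distrib]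
        refine Finset.sum_congr rfl fun j _ => ?_
        rw [show n + 1 + (j + 1) = (n + 1 + j) + 1 by ring, Nat.choose_succ_succ,
          show n + (j + 1) = n + 1 + j by ring]
        push_cast; ring
      simp at h1 h2 h3
      linarith
    have hpos := ih (fun j => a (j + 1)) 0 (n0 + 1) hdiff
    intro j hj1 hjD
    rcases Nat.lt_or_ge 1 j with h2 | h2
    · have := hpos (j - 1) (by omega) (by omega)
      simpa [show j - 1 + 1 = j by omega] using this
    · obtain rfl : j = 1 := by omega
      have h1 := hdiff (n0 + 1) le_rfl
      rw [Finset.sum_range_succ', Finset.sum_eq_zero] at h1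
      · simpa using h1
      · intro i hi
        rw [hpos (i + 1) (by omega) (by have := Finset.mem_range.1 hi; omega), zero_mul]
end ChernAux

namespace ChernAux
open IsLocalRing Module

lemma eq_closedPoint_of_finiteLength {R : Type*} [CommRing R] [IsNoetherianRing R] [IsLocalRing R]
    {K : Type*} [AddCommGroup K] [Module R K] (h : IsFiniteLength R K) {q : PrimeSpectrum R}
    (hq : q ∈ support R K) : q = closedPoint R := by
  obtain ⟨h1, h2⟩ := isFiniteLength_iff_isNoetherian_isArtinian.1 h
  obtain ⟨n, hn⟩ := IsArtinian.monotone_stabilizes (R := R) (M := K)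
    ⟨fun n => OrderDual.toDual (maximalIdeal R ^ n • ⊤ : Submodule R K), fun a b hab =>
      OrderDual.toDual_le_toDual.2 (Submodule.smul_mono_left (Ideal.pow_le_pow_right hab))⟩
  have h3 : (maximalIdeal R ^ n • ⊤ : Submodule R K) = maximalIdeal R ^ (n + 1) • ⊤ :=
    hn (n + 1) (by omega)
  have h4 : (maximalIdeal R ^ n • ⊤ : Submodule R K) = ⊥ := by
    refine Submodule.eq_bot_of_le_smul_of_le_jacobson_bot (maximalIdeal R) _
      (IsNoetherian.noetherian _) ?_ (maximalIdeal_le_jacobson _)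
    rw [← mul_smul, ← pow_succ', ← h3]
  have h5 : maximalIdeal R ^ n ≤ q.asIdeal := by
    refine le_trans (fun r hr => ?_) (annihilator_le_of_mem_support hq)
    rw [Module.mem_annihilator]
    intro y
    have : r • y ∈ (maximalIdeal R ^ n • ⊤ : Submodule R K) := Submodule.smul_mem_smul hr trivial
    rw [h4] at this
    simpa using this
  have h6 : maximalIdeal R ≤ q.asIdeal := Ideal.IsPrime.le_of_pow_le h5
  exact PrimeSpectrum.ext (le_antisymm (le_maximalIdeal q.2.ne_top) h6)

lemma exists_inf_eq_bot {R : Type*} [CommRing R] [IsNoetherianRing R] [IsLocalRing R]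
    {M : Type*} [AddCommGroup M] [Module R M] [Module.Finite R M] (J : Ideal R)
    (hJ : J ≤ maximalIdeal R) (N : Submodule R M)
    (hN : ∀ y ∈ N, ∃ k : ℕ, ∀ r ∈ maximalIdeal R ^ k, r • y = 0) :
    ∃ n1, ∀ n ≥ n1, (J ^ n • ⊤ : Submodule R M) ⊓ N = ⊥ := by
  obtain ⟨s, hs⟩ := IsNoetherian.noetherian N
  have hsN : ∀ y ∈ s, y ∈ N := fun y hy => hs ▸ Submodule.subset_span hy
  choose! k hk using hN
  have hkill : ∀ n ≥ s.sup k, maximalIdeal R ^ n • N = ⊥ := by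
    intro n hn
    rw [eq_bot_iff, Submodule.smul_le]
    intro r hr y hy
    rw [← hs] at hy
    rw [Submodule.mem_bot]
    induction hy using Submodule.span_induction with
    | mem y hy =>
      exact hk y (hsN y hy) r (Ideal.pow_le_pow_right ((Finset.le_sup hy).trans hn) hr)
    | zero => simp
    | add a b _ _ ha hb => rw [smul_add, ha, hb, add_zero]
    | smul t a _ ha => rw [smul_comm, ha, smul_zero]
  obtain ⟨c, hc⟩ := Ideal.exists_pow_inf_eq_pow_smul J N
  refine ⟨c + s.sup k, fun n hn => ?_⟩
  rw [hc n (by omega), eq_bot_iff, ← hkill (n - c) (by omega)]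
  exact Submodule.smul_mono (Ideal.pow_right_mono hJ _) inf_le_right

lemma length_add {R : Type*} [CommRing R] {M : Type*} [AddCommGroup M] [Module R M]
    (N : Submodule R M) (I : Ideal R) (h : (I • ⊤ : Submodule R M) ⊓ N = ⊥) :
    Module.length R (M ⧸ (I • ⊤ : Submodule R M)) =
      Module.length R N + Module.length R ((M ⧸ N) ⧸ (I • ⊤ : Submodule R (M ⧸ N))) := by
  have mapI : Submodule.map N.mkQ (I • ⊤) = (I • ⊤ : Submodule R (M ⧸ N)) := by
    rw [Submodule.map_smul'', Submodule.map_top, Submodule.range_mkQ]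
  let f : N →ₗ[R] M ⧸ (I • ⊤ : Submodule R M) := (Submodule.mkQ _).comp N.subtype
  let g := Submodule.mapQ (I • ⊤ : Submodule R M) (I • ⊤ : Submodule R (M ⧸ N)) N.mkQ
    (Submodule.map_le_iff_le_comap.1 mapI.le)
  refine Module.length_eq_add_of_exact f g ?_ ?_ ?_
  · rw [injective_iff_map_eq_zero]
    intro y hy
    have h1 : (y : M) ∈ (I • ⊤ : Submodule R M) := by
      rw [← Submodule.Quotient.mk_eq_zero]; exact hy
    have h2 : (y : M) ∈ (I • ⊤ : Submodule R M) ⊓ N := ⟨h1, y.2⟩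
    rw [h] at h2
    exact Subtype.ext (by simpa using h2)
  · intro b
    obtain ⟨b, rfl⟩ := Submodule.Quotient.mk_surjective _ b
    obtain ⟨m, rfl⟩ := Submodule.Quotient.mk_surjective _ b
    exact ⟨Submodule.Quotient.mk m, rfl⟩
  · intro b
    obtain ⟨m, rfl⟩ := Submodule.Quotient.mk_surjective _ b
    constructor
    · intro hb
      have h1 : N.mkQ m ∈ (I • ⊤ : Submodule R (M ⧸ N)) := by
        rw [← Submodule.Quotient.mk_eq_zero]; exact hb
      rw [← mapI] at h1
      obtain ⟨l, hl, hlm⟩ := h1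
      rw [Submodule.mkQ_apply, Submodule.mkQ_apply, eq_comm, Submodule.Quotient.eq] at hlm
      refine ⟨⟨m - l, hlm⟩, ?_⟩
      change Submodule.Quotient.mk (m - l) = _
      rw [Submodule.Quotient.eq]
      have : m - l - m = -l := by abel
      rw [this]
      exact neg_mem hl
    · rintro ⟨y, hy⟩
      rw [← hy]
      change Submodule.Quotient.mk (N.mkQ (y : M)) = _
      have h0 : N.mkQ (y : M) = 0 := by simp
      rw [h0]; rfl
end ChernAux

/-- Let `(R, m)` be a Noetherian local ring and `M` a finite `R`-module of
dimension `d ≥ 2`.  Let `J` be a parameter ideal for `M`.  If `M ⧸ H⁰_m(M)` is Cohen–Macaulay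
(necessarily of dimension `d`), then `e₁(J, M) = 0`, where the Hilbert coefficients
`e i = eᵢ(J, M)` satisfy `λ(M/J^(n+1)M) = ∑ᵢ (−1)ⁱ eᵢ(J,M) · C(n + d − i, d − i)` for
`n ≫ 0`. -/
theorem chern_number_zero_of_quotient_CM {R M : Type*} [CommRing R] [IsNoetherianRing R]
    [IsLocalRing R] [AddCommGroup M] [Module R M] [Module.Finite R M]
    (d : ℕ) (hd : 2 ≤ d) (hdim : ringKrullDim (R ⧸ Module.annihilator R M) = d)
    (N : Submodule R M)
    (hN : ∀ x : M, x ∈ N ↔ ∃ k : ℕ, ∀ r ∈ (IsLocalRing.maximalIdeal R) ^ k, r • x = 0)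
    (hCM : IsCMofDim R (M ⧸ N) d)
    (x : Fin d → R) (hx : ∀ i, x i ∈ IsLocalRing.maximalIdeal R)
    (J : Ideal R) (hJ : J = Ideal.span (Set.range x))
    (len : ℕ → ℕ) (hlen : ∀ n, HasLength R (M ⧸ (J ^ (n + 1) • ⊤ : Submodule R M)) (len n))
    (e : ℕ → ℤ) (n0 : ℕ)
    (he : ∀ n ≥ n0, (len n : ℤ) =
      ∑ i ∈ Finset.range (d + 1), (-1) ^ i * e i * ((n + d - i).choose (d - i) : ℤ)) :
    e 1 = 0 := by
  have hlen' : ∀ n, Module.length R (M ⧸ (J ^ (n + 1) • ⊤ : Submodule R M)) = len n := by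
    intro n
    obtain ⟨s, h1, h2, h3⟩ := hlen n
    rw [← Module.length_compositionSeries s h1 h2, h3]
  have hJm : J ≤ IsLocalRing.maximalIdeal R := by
    rw [hJ, Ideal.span_le]; rintro _ ⟨i, rfl⟩; exact hx i
  have hJl : J = Ideal.ofList (List.ofFn x) := by
    rw [hJ]; unfold Ideal.ofList; congr 1; ext r; simp [List.mem_ofFn]
  obtain ⟨-, rs, hrl, hrm, hreg⟩ := hCM
  have hxm : ∀ r ∈ List.ofFn x, r ∈ IsLocalRing.maximalIdeal R := by
    intro r hr
    obtain ⟨i, rfl⟩ := (List.mem_ofFn' _ _).1 hr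
    exact hx i
  have hwr : RingTheory.Sequence.IsWeaklyRegular (M ⧸ N) (List.ofFn x) := by
    refine ChernAux.isRegular_of_sop (List.ofFn x) hxm ⟨rs, by simpa using hrl, hrm, hreg⟩ ?_
    intro q hq hxq
    have hJq : J ≤ q.asIdeal := by
      rw [hJl]; exact Ideal.span_le.2 hxq
    have hqM : q ∈ Module.support R (M ⧸ (J ^ (0 + 1) • ⊤ : Submodule R M)) := by
      rw [Module.support_quotient]
      refine ⟨Module.support_subset_of_surjective N.mkQ N.mkQ_surjective hq, ?_⟩
      rw [zero_add, pow_one]; exact hJq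
    have hfl : IsFiniteLength R (M ⧸ (J ^ (0 + 1) • ⊤ : Submodule R M)) := by
      rw [← Module.length_ne_top_iff, hlen']; simp
    exact ChernAux.eq_closedPoint_of_finiteLength hfl hqM
  have hH := fun n => ChernAux.length_pow (List.ofFn x) (M := M ⧸ N) hxm hwr n
  rw [← hJl, List.length_ofFn] at hH
  obtain ⟨n1, hn1⟩ := ChernAux.exists_inf_eq_bot J hJm N (fun y hy => (hN y).1 hy)
  have hadd : ∀ n ≥ n1, (len n : ℕ∞) = Module.length R N + ((n + d).choose d : ℕ) *
      Module.length R ((M ⧸ N) ⧸ (J • ⊤ : Submodule R (M ⧸ N))) := by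
    intro n hn
    rw [← hlen', ← hH]
    exact ChernAux.length_add N (J ^ (n + 1)) (hn1 (n + 1) (by omega))
  have hadd1 := hadd n1 le_rfl
  have hNt : Module.length R N ≠ ⊤ := by
    intro h; rw [h, top_add] at hadd1; exact ENat.coe_ne_top _ hadd1
  have hct : Module.length R ((M ⧸ N) ⧸ (J • ⊤ : Submodule R (M ⧸ N))) ≠ ⊤ := by
    intro h
    rw [h, ENat.mul_top (by
      have : 0 < (n1 + d).choose d := Nat.choose_pos (by omega)
      exact_mod_cast this.ne'), add_top] at hadd1
    exact ENat.coe_ne_top _ hadd1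
  obtain ⟨a, ha⟩ := ENat.ne_top_iff_exists.1 hNt
  obtain ⟨c, hc⟩ := ENat.ne_top_iff_exists.1 hct
  rw [← ha, ← hc] at hadd
  have hadd' : ∀ n ≥ n1, len n = a + (n + d).choose d * c := fun n hn => by
    exact_mod_cast hadd n hn
  have := ChernAux.binom_indep d
    (fun j => (-1) ^ (d - j) * e (d - j) - if j = d then (c : ℤ) else 0) a (max n0 n1) (by
      intro n hn
      have h1 := he n (le_trans (le_max_left _ _) hn)
      have h2 := hadd' n (le_trans (le_max_right _ _) hn)
      rw [← Finset.sum_range_reflect] at h1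
      simp only [sub_mul, Finset.sum_sub_distrib, ite_mul, zero_mul]
      rw [Finset.sum_ite_eq' , if_pos (by simp)]
      have h3 : ∑ j ∈ Finset.range (d + 1), (-1) ^ (d - j) * e (d - j) * ((n + j).choose j : ℤ) =
          len n := by
        rw [h1]
        refine Finset.sum_congr rfl fun j hj => ?_
        have := Finset.mem_range.1 hj
        rw [show d + 1 - 1 - j = d - j by omega, show n + d - (d - j) = n + j by omega,
          show d - (d - j) = j by omega]
      rw [h3, h2]; push_cast; ring) (d - 1) (by omega) (by omega)
  simpa [show d - (d - 1) = 1 by omega, show d - 1 ≠ d by omega] using this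
end

section
/- Let (R,m) be a Noetherian local ring and M a finite R-module with dim M = d ≥ 1. For any ideal J generated by a system of parameters for M, e_1(J,M) ≤ 0. -/
open MvPolynomial IsLocalRing

set_option linter.unusedSectionVars false

lemma aux_length_homog (R : Type*) [CommRing R] [IsLocalRing R] (d n : ℕ) :
    Module.length R (homogeneousSubmodule (Fin d) (ResidueField R) n) = (d.multichoose n : ℕ) := by
  rw [Module.length_eq_of_surjective (R := ResidueField R) (residue_surjective (R := R))]
  have e : homogeneousSubmodule (Fin d) (ResidueField R) n ≃ₗ[ResidueField R]
      ({α : Fin d →₀ ℕ | α.degree = n} →₀ ResidueField R) :=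
    (LinearEquiv.ofEq _ _ (homogeneousSubmodule_eq_finsupp_supported _ _ n)).trans
      (AddMonoidAlgebra.supportedEquivFinsupp _)
  have hs : {α : Fin d →₀ ℕ | α.degree = n} =
      ((Finset.univ : Finset (Fin d)).finsuppAntidiag n : Set (Fin d →₀ ℕ)) := by
    ext α
    simp [Finsupp.degree_eq_sum]
  rw [hs] at e
  have := Finset.card_finsuppAntidiag_nat_eq_multichoose (s := (Finset.univ : Finset (Fin d))) n
  rw [Finset.card_univ, Fintype.card_fin] at this
  have hc : ENat.card ((Finset.univ : Finset (Fin d)).finsuppAntidiag n : Set (Fin d →₀ ℕ)) =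
      (((Finset.univ : Finset (Fin d)).finsuppAntidiag n).card : ℕ∞) := by
    rw [ENat.card_coe_set_eq, Set.encard_coe_eq_coe_finsetCard]
  rw [e.length_eq, Module.length_finsupp, ← this, hc, Module.length_eq_one, mul_one]

lemma aux_length_split {R M : Type*} [CommRing R] [AddCommGroup M] [Module R M]
    {A B : Submodule R M} (h : A ≤ B) :
    Module.length R (M ⧸ A) = Module.length R (B.map A.mkQ) + Module.length R (M ⧸ B) := by
  rw [← (Submodule.quotientQuotientEquivQuotient A B h).length_eq]
  exact Module.length_eq_add_of_exact (B.map A.mkQ).subtype (B.map A.mkQ).mkQ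
    (Submodule.injective_subtype _) (Submodule.mkQ_surjective _)
    (LinearMap.exact_subtype_mkQ _)

section
variable {R M : Type*} [CommRing R] [IsLocalRing R] [AddCommGroup M] [Module R M]

/-- evaluation map -/
noncomputable def auxPhi {d : ℕ} (x : Fin d → R) (y : M) (N : Submodule R M) (n : ℕ) :
    homogeneousSubmodule (Fin d) R n →ₗ[R] M ⧸ N :=
  N.mkQ ∘ₗ (LinearMap.toSpanSingleton R M y) ∘ₗ (aeval (R := R) x).toLinearMap ∘ₗ
    (homogeneousSubmodule (Fin d) R n).subtype

lemma auxPhi_apply {d : ℕ} (x : Fin d → R) (y : M) (N : Submodule R M) (n : ℕ)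
    (p : homogeneousSubmodule (Fin d) R n) :
    auxPhi x y N n p = N.mkQ (eval x p.1 • y) := by
  simp [auxPhi, aeval_eq_eval]

/-- reduction map -/
noncomputable def auxTheta (R : Type*) [CommRing R] [IsLocalRing R] (d n : ℕ) :
    homogeneousSubmodule (Fin d) R n →ₗ[R] homogeneousSubmodule (Fin d) (ResidueField R) n where
  toFun p := ⟨map (residue R) p.1, IsHomogeneous.map p.2 _⟩
  map_add' p q := by ext1; simp
  map_smul' r p := by
    ext1
    simp [Algebra.smul_def]

lemma auxTheta_surj (d n : ℕ) : Function.Surjective (auxTheta R d n) := by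
  rintro ⟨p, hp⟩
  obtain ⟨q, rfl⟩ := map_surjective (residue R) residue_surjective p
  refine ⟨⟨homogeneousComponent n q, homogeneousComponent_isHomogeneous n q⟩, ?_⟩
  ext1
  have := homogeneousComponent_of_mem (m := n) hp
  simp only [if_true] at this
  change map (residue R) (homogeneousComponent n q) = map (residue R) q
  conv_rhs => rw [← this]
  ext α
  simp only [coeff_map, coeff_homogeneousComponent]
  split_ifs <;> simp

lemma aux_coeff_mem {d n : ℕ} (p : homogeneousSubmodule (Fin d) R n)
    (hp : auxTheta R d n p = 0) (α) : p.1.coeff α ∈ maximalIdeal R := by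
  have : map (residue R) p.1 = 0 := congrArg Subtype.val hp
  have := congrArg (coeff α) this
  rwa [coeff_map, coeff_zero, residue_eq_zero_iff] at this

variable {d : ℕ} (x : Fin d → R) (F F' : Submodule R M)

lemma aux_eval_mem {n : ℕ} (p : homogeneousSubmodule (Fin d) R n) :
    eval x p.1 ∈ (Ideal.span (Set.range x)) ^ n :=
  (Ideal.mem_span_pow_iff_exists_isHomogeneous x _).2 ⟨p.1, p.2, rfl⟩

lemma aux_ker_le {y : M} (hy : ∀ r ∈ maximalIdeal R, r • y ∈ F) (n : ℕ) :
    LinearMap.ker (auxTheta R d n) ≤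
      LinearMap.ker (auxPhi x y ((Ideal.span (Set.range x)) ^ n • F) n) := by
  intro p hp
  rw [LinearMap.mem_ker] at hp ⊢
  rw [auxPhi_apply, Submodule.mkQ_apply, Submodule.Quotient.mk_eq_zero,
    eval_eq, Finset.sum_smul]
  refine Submodule.sum_mem _ fun α hα => ?_
  rw [mul_comm, mul_smul]
  refine Submodule.smul_mem_smul ?_ (hy _ (aux_coeff_mem p hp α))
  have hα' : α.degree = n := by
    have := p.2 (mem_support_iff.1 hα)
    rw [Finsupp.degree_eq_weight_one]; exact this
  have := aux_eval_mem x (n := n) ⟨monomial α 1, isHomogeneous_monomial 1 hα'⟩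
  rwa [eval_monomial, one_mul] at this

lemma aux_range {y : M} (hF : F' = F ⊔ R ∙ y) (n : ℕ) :
    LinearMap.range (auxPhi x y ((Ideal.span (Set.range x)) ^ n • F) n) =
      ((Ideal.span (Set.range x)) ^ n • F').map ((Ideal.span (Set.range x)) ^ n • F).mkQ := by
  subst hF
  rw [Submodule.smul_sup, Submodule.map_sup, Submodule.mkQ_map_self, bot_sup_eq]
  apply le_antisymm
  · rintro _ ⟨p, rfl⟩
    rw [auxPhi_apply]
    exact Submodule.mem_map_of_mem (Submodule.smul_mem_smul (aux_eval_mem x p)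
      (Submodule.mem_span_singleton_self y))
  · rw [Submodule.map_le_iff_le_comap, Submodule.smul_le]
    intro r hr m hm
    obtain ⟨s, rfl⟩ := Submodule.mem_span_singleton.1 hm
    obtain ⟨p, hp, hpr⟩ := (Ideal.mem_span_pow_iff_exists_isHomogeneous x _).1 hr
    refine ⟨s • ⟨p, hp⟩, ?_⟩
    rw [map_smul, auxPhi_apply, hpr, ← map_smul, smul_comm]

/-- image of relations in the polynomial ring over the residue field -/
noncomputable def auxK (y : M) (n : ℕ) :
    Submodule R (homogeneousSubmodule (Fin d) (ResidueField R) n) :=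
  (LinearMap.ker (auxPhi x y ((Ideal.span (Set.range x)) ^ n • F) n)).map (auxTheta R d n)

lemma aux_length_eq {y : M} (hF : F' = F ⊔ R ∙ y) (hy : ∀ r ∈ maximalIdeal R, r • y ∈ F) (n : ℕ) :
    Module.length R
      (((Ideal.span (Set.range x)) ^ n • F').map ((Ideal.span (Set.range x)) ^ n • F).mkQ) =
    Module.length R (homogeneousSubmodule (Fin d) (ResidueField R) n ⧸ auxK x F y n) := by
  rw [← aux_range x F F' hF]
  rw [← (LinearMap.quotKerEquivRange _).length_eq]
  have hs : Function.Surjective ((auxK x F y n).mkQ ∘ₗ auxTheta R d n) :=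
    (Submodule.mkQ_surjective _).comp (auxTheta_surj d n)
  rw [← (LinearMap.quotKerEquivOfSurjective _ hs).length_eq]
  refine (Submodule.quotEquivOfEq _ _ ?_).length_eq
  rw [LinearMap.ker_comp, Submodule.ker_mkQ, auxK, Submodule.comap_map_eq,
    sup_eq_left.2 (aux_ker_le x F hy n)]

lemma aux_mul {y : M} {a n : ℕ} (f : homogeneousSubmodule (Fin d) (ResidueField R) a)
    (hf : f ∈ auxK x F y a) (g : homogeneousSubmodule (Fin d) (ResidueField R) n)
    (h : homogeneousSubmodule (Fin d) (ResidueField R) (a + n)) (hh : h.1 = f.1 * g.1) :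
    h ∈ auxK x F y (a + n) := by
  obtain ⟨p, hp, rfl⟩ := hf
  obtain ⟨q, rfl⟩ := auxTheta_surj d n g
  refine ⟨⟨p.1 * q.1, IsHomogeneous.mul p.2 q.2⟩, ?_, ?_⟩
  · rw [SetLike.mem_coe, LinearMap.mem_ker, auxPhi_apply, Submodule.mkQ_apply,
      Submodule.Quotient.mk_eq_zero] at hp ⊢
    rw [eval_mul, mul_comm, mul_smul, add_comm, pow_add, Submodule.mul_smul]
    exact Submodule.smul_mem_smul (aux_eval_mem x q) hp
  · ext1
    rw [hh]
    exact map_mul (map (residue R)) _ _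

lemma aux_bad {y : M} {a : ℕ} (f : homogeneousSubmodule (Fin d) (ResidueField R) a)
    (hf : f ∈ auxK x F y a) (hf0 : f ≠ 0) (n : ℕ) :
    (d.multichoose n : ℕ∞) ≤ Module.length R (auxK x F y (a + n)) := by
  rw [← aux_length_homog R d n]
  have hf0' : f.1 ≠ 0 := fun h => hf0 (Subtype.ext h)
  let μ : homogeneousSubmodule (Fin d) (ResidueField R) n →ₗ[R] auxK x F y (a + n) :=
    { toFun := fun g => ⟨⟨f.1 * g.1, IsHomogeneous.mul f.2 g.2⟩, aux_mul x F f hf g _ rfl⟩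
      map_add' := fun g g' => by ext1; ext1; simp [mul_add]
      map_smul' := fun r g => by ext1; ext1; simp }
  refine Module.length_le_of_injective μ ?_
  intro g g' h
  have : f.1 * g.1 = f.1 * g'.1 := congrArg (fun z => z.1.1) h
  exact Subtype.ext (mul_left_cancel₀ hf0' this)

lemma aux_step (hFF : F ⋖ F') :
    ∃ h : ℕ → ℕ, (∀ n, Module.length R (M ⧸ ((Ideal.span (Set.range x)) ^ n • F)) =
        h n + Module.length R (M ⧸ ((Ideal.span (Set.range x)) ^ n • F'))) ∧
      ((∀ n, h n = d.multichoose n) ∨ (∃ a, ∀ n, h n ≤ d.multichoose n ∧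
        h (a + n) + d.multichoose n ≤ d.multichoose (a + n))) := by
  obtain ⟨y, hyF', hyF⟩ := SetLike.exists_of_lt hFF.1
  have hle : F < F ⊔ R ∙ y := by
    refine lt_of_le_of_ne le_sup_left fun h => hyF ?_
    rw [h]
    exact Submodule.mem_sup_right (Submodule.mem_span_singleton_self y)
  have hF : F' = F ⊔ R ∙ y := by
    refine (eq_of_le_of_not_lt (sup_le hFF.1.le ?_) (hFF.2 hle)).symm
    rwa [Submodule.span_singleton_le_iff_mem]
  have hy : ∀ r ∈ maximalIdeal R, r • y ∈ F := by
    intro r hr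
    by_contra hry
    have h1 : F < F ⊔ R ∙ (r • y) := by
      refine lt_of_le_of_ne le_sup_left fun h => hry ?_
      rw [h]
      exact Submodule.mem_sup_right (Submodule.mem_span_singleton_self _)
    have h2 : F ⊔ R ∙ (r • y) = F' := by
      refine eq_of_le_of_not_lt (sup_le hFF.1.le ?_) (hFF.2 h1)
      rw [Submodule.span_singleton_le_iff_mem]
      exact F'.smul_mem r hyF'
    rw [← h2] at hyF'
    obtain ⟨u, hu, v, hv, huv⟩ := Submodule.mem_sup.1 hyF'
    obtain ⟨s, rfl⟩ := Submodule.mem_span_singleton.1 hv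
    have hunit : IsUnit (1 - s * r) :=
      by
        have := (IsLocalRing.mem_maximalIdeal _).1 ((maximalIdeal R).mul_mem_left s hr)
        exact (IsLocalRing.isUnit_or_isUnit_one_sub_self _).resolve_left this
    have : (1 - s * r) • y ∈ F := by
      rw [sub_smul, one_smul, mul_smul, sub_eq_iff_eq_add.2 huv.symm]
      exact hu
    exact hyF ((Submodule.smul_mem_iff_of_isUnit _ hunit).1 this)
  have hadd : ∀ n, (d.multichoose n : ℕ∞) = Module.length R (auxK x F y n) +
      Module.length R (homogeneousSubmodule (Fin d) (ResidueField R) n ⧸ auxK x F y n) := by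
    intro n
    rw [← aux_length_homog R d n]
    exact Module.length_eq_add_of_exact (auxK x F y n).subtype (auxK x F y n).mkQ
      (Submodule.injective_subtype _) (Submodule.mkQ_surjective _)
      (LinearMap.exact_subtype_mkQ _)
  have hfin : ∀ n, ∃ h : ℕ, (h : ℕ∞) =
      Module.length R (homogeneousSubmodule (Fin d) (ResidueField R) n ⧸ auxK x F y n) := by
    intro n
    refine ENat.ne_top_iff_exists.1 fun h => ?_
    have := hadd n
    rw [h, add_top] at this
    exact ENat.natCast_ne_top _ this
  choose h hh using hfin
  refine ⟨h, fun n => ?_, ?_⟩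
  · rw [hh, ← aux_length_eq x F F' hF hy]
    exact aux_length_split (Submodule.smul_mono le_rfl hFF.1.le)
  · by_cases hK : ∀ n, auxK x F y n = ⊥
    · left
      intro n
      have := hadd n
      rw [← hh, hK, Module.length_bot, zero_add] at this
      exact_mod_cast this.symm
    · right
      push Not at hK
      obtain ⟨a, ha⟩ := hK
      obtain ⟨f, hf, hf0⟩ := Submodule.exists_mem_ne_zero_of_ne_bot ha
      refine ⟨a, fun n => ⟨?_, ?_⟩⟩
      · have : (h n : ℕ∞) ≤ (d.multichoose n : ℕ∞) := by
          rw [hadd n, ← hh]; exact le_add_self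
        exact_mod_cast this
      · have : (h (a + n) : ℕ∞) + d.multichoose n ≤ (d.multichoose (a + n) : ℕ∞) := by
          rw [hadd (a + n), ← hh, add_comm]
          exact add_le_add_left (aux_bad x F f hf hf0 n) _
        exact_mod_cast this
end

lemma aux_mc_mono {d : ℕ} (hd : 1 ≤ d) {m n : ℕ} (h : m ≤ n) :
    d.multichoose m ≤ d.multichoose n := by
  obtain ⟨D, rfl⟩ := Nat.exists_eq_add_of_le' hd
  rw [Nat.multichoose_eq, Nat.multichoose_eq,
    show D + 1 + m - 1 = D + m by omega, show D + 1 + n - 1 = D + n by omega,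
    ← Nat.choose_symm_add, ← Nat.choose_symm_add]
  exact Nat.choose_le_choose _ (by omega)

lemma aux_bad_sum {d : ℕ} (hd : 1 ≤ d) (h : ℕ → ℕ) (a : ℕ)
    (ha : ∀ n, h n ≤ d.multichoose n ∧ h (a + n) + d.multichoose n ≤ d.multichoose (a + n))
    (n : ℕ) : ∑ j ∈ Finset.range (n + 1), h j ≤ a * d.multichoose n := by
  rcases le_total (n + 1) a with hn | hn
  · calc ∑ j ∈ Finset.range (n + 1), h j ≤ ∑ j ∈ Finset.range (n + 1), d.multichoose n := by
          refine Finset.sum_le_sum fun j hj => (ha j).1.trans (aux_mc_mono hd ?_)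
          have := Finset.mem_range.1 hj
          omega
      _ = (n + 1) * d.multichoose n := by simp
      _ ≤ _ := Nat.mul_le_mul_right _ hn
  · obtain ⟨N, hN⟩ := Nat.exists_eq_add_of_le hn
    have h1 : ∑ j ∈ Finset.range (a + N), h j + ∑ i ∈ Finset.range N, d.multichoose i ≤
        ∑ j ∈ Finset.range (a + N), d.multichoose j := by
      rw [Finset.sum_range_add, Finset.sum_range_add, add_assoc, ← Finset.sum_add_distrib]
      exact add_le_add (Finset.sum_le_sum fun j _ => (ha j).1)
        (Finset.sum_le_sum fun j _ => (ha j).2)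
    have h2 : ∑ j ∈ Finset.range (a + N), d.multichoose j ≤
        ∑ i ∈ Finset.range N, d.multichoose i + a * d.multichoose n := by
      rw [add_comm a N, Finset.sum_range_add]
      refine Nat.add_le_add_left ?_ _
      calc _ ≤ ∑ j ∈ Finset.range a, d.multichoose n := by
            refine Finset.sum_le_sum fun j hj => aux_mc_mono hd ?_
            have := Finset.mem_range.1 hj
            omega
        _ = _ := by simp
    rw [hN]
    omega

lemma aux_asym (d : ℕ) (a : ℕ → ℤ) (n0 : ℕ)
    (h : ∀ n ≥ n0, 0 ≤ ∑ i ∈ Finset.range (d + 1), a i * ((n + (d - i)).choose (d - i) : ℤ)) :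
    0 ≤ a 0 := by
  rcases d with _ | D
  · simpa using h n0 le_rfl
  by_contra hneg
  set S : ℕ := ∑ i ∈ Finset.range (D + 1), (a (i + 1)).natAbs with hS
  set n := n0 + S * (D + 1) with hn
  have h1 := h n (by omega)
  rw [Finset.sum_range_succ'] at h1
  have h2 : ∑ i ∈ Finset.range (D + 1), a (i + 1) *
      ((n + (D + 1 - (i + 1))).choose (D + 1 - (i + 1)) : ℤ) ≤ S * ((n + D).choose D : ℤ) := by
    rw [hS, Nat.cast_sum, Finset.sum_mul]
    refine Finset.sum_le_sum fun i hi => ?_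
    have hle : (n + (D + 1 - (i + 1))).choose (D + 1 - (i + 1)) ≤ (n + D).choose D := by
      rw [← Nat.choose_symm_add, ← Nat.choose_symm_add]
      exact Nat.choose_le_choose _ (by omega)
    have hab : a (i + 1) ≤ ((a (i + 1)).natAbs : ℤ) := Int.le_natAbs
    calc _ ≤ ((a (i + 1)).natAbs : ℤ) *
          ((n + (D + 1 - (i + 1))).choose (D + 1 - (i + 1)) : ℤ) :=
          mul_le_mul_of_nonneg_right hab (by positivity)
      _ ≤ _ := mul_le_mul_of_nonneg_left (by exact_mod_cast hle) (by positivity)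
  have h3 : ((n + D + 1 : ℕ) : ℤ) * ((n + D).choose D : ℤ) =
      ((n + D + 1).choose (D + 1) : ℤ) * ((D + 1 : ℕ) : ℤ) := by
    exact_mod_cast Nat.add_one_mul_choose_eq (n + D) D
  simp only [Nat.sub_zero] at h1
  rw [show n + (D + 1) = n + D + 1 by omega] at h1
  have hpos : 0 < ((n + D).choose D : ℤ) := by
    exact_mod_cast Nat.choose_pos (by omega)
  have hC : (0 : ℤ) ≤ ((n + D + 1).choose (D + 1) : ℤ) := by positivity
  have h4 : ((n + D + 1).choose (D + 1) : ℤ) ≤ S * ((n + D).choose D : ℤ) := by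
    nlinarith
  have h5 : ((n + D + 1 : ℕ) : ℤ) * ((n + D).choose D : ℤ) ≤
      ((S * (D + 1) : ℕ) : ℤ) * ((n + D).choose D : ℤ) := by
    rw [h3]; push_cast; nlinarith
  have h6 := le_of_mul_le_mul_right h5 hpos
  have h7 : n + D + 1 ≤ S * (D + 1) := by exact_mod_cast h6
  omega

lemma aux_chain {R M : Type*} [CommRing R] [IsLocalRing R] [AddCommGroup M] [Module R M]
    {d : ℕ} (hd : 1 ≤ d) (x : Fin d → R) (J : Ideal R) (hJ : J = Ideal.span (Set.range x))
    (s : CompositionSeries (Submodule R (M ⧸ (J ^ (0 + 1) • ⊤ : Submodule R M))))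
    (hs : s.head = ⊥) (i : Fin (s.length + 1)) :
    ∃ g : ℕ → ℕ, (∀ n, Module.length R (M ⧸ (J ^ (n + 1) • ⊤ : Submodule R M)) =
      g n + Module.length R (M ⧸ (J ^ n • (s i).comap (Submodule.mkQ _) : Submodule R M))) ∧
      ∃ c B : ℕ, ∀ n, c * (n + d).choose d ≤ ∑ j ∈ Finset.range (n + 1), g j ∧
        ∑ j ∈ Finset.range (n + 1), g j ≤ c * (n + d).choose d + B * d.multichoose n := by
  induction i using Fin.induction with
  | zero =>
    refine ⟨fun _ => 0, fun n => ?_, 0, 0, fun n => by simp⟩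
    have : s 0 = ⊥ := hs
    rw [this, Submodule.comap_bot, Submodule.ker_mkQ, ← Submodule.mul_smul, zero_add, pow_one,
      ← pow_succ]
    simp
  | succ i ih =>
    obtain ⟨g, hg, c, B, hcB⟩ := ih
    have hcov := Submodule.comap_covBy_of_surjective
      (Submodule.mkQ_surjective (J ^ (0 + 1) • ⊤ : Submodule R M)) (s.step i)
    obtain ⟨h, hh, hcase⟩ := aux_step x _ _ hcov
    rw [← hJ] at hh
    refine ⟨fun n => g n + h n, fun n => ?_, ?_⟩
    · rw [hg n, hh n]
      push_cast
      rw [add_assoc]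
    · simp_rw [Finset.sum_add_distrib]
      rcases hcase with hgood | ⟨a, ha⟩
      · refine ⟨c + 1, B, fun n => ?_⟩
        have : ∑ j ∈ Finset.range (n + 1), h j = (n + d).choose d := by
          rw [← Nat.sum_range_multichoose]
          exact Finset.sum_congr rfl fun j _ => hgood j
        have := hcB n
        constructor <;> linarith
      · refine ⟨c, B + a, fun n => ?_⟩
        have := aux_bad_sum hd h a ha n
        have := hcB n
        rw [add_mul]
        constructor <;> omega

/-- Let `(R, m)` be a Noetherian local ring and `M` a finite `R`-module with
`dim M = d ≥ 1`.  For any ideal `J` generated by a system of parameters for `M`, the Chern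
number satisfies `e₁(J, M) ≤ 0`.  Here the Hilbert coefficients `e i = eᵢ(J, M)` are (the
necessarily unique) integers such that
`λ(M/J^(n+1)M) = ∑ᵢ (−1)ⁱ eᵢ(J,M) · C(n + d − i, d − i)` for all `n ≫ 0`. -/
theorem chern_number_nonpos {R M : Type*} [CommRing R] [IsNoetherianRing R]
    [IsLocalRing R] [AddCommGroup M] [Module R M] [Module.Finite R M]
    (d : ℕ) (hd : 1 ≤ d) (hdim : ringKrullDim (R ⧸ Module.annihilator R M) = d)
    (x : Fin d → R) (hx : ∀ i, x i ∈ IsLocalRing.maximalIdeal R)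
    (J : Ideal R) (hJ : J = Ideal.span (Set.range x))
    (len : ℕ → ℕ) (hlen : ∀ n, HasLength R (M ⧸ (J ^ (n + 1) • ⊤ : Submodule R M)) (len n))
    (e : ℕ → ℤ) (n0 : ℕ)
    (he : ∀ n ≥ n0, (len n : ℤ) =
      ∑ i ∈ Finset.range (d + 1), (-1) ^ i * e i * ((n + d - i).choose (d - i) : ℤ)) :
    e 1 ≤ 0 := by
  have hL : ∀ n, Module.length R (M ⧸ (J ^ (n + 1) • ⊤ : Submodule R M)) = (len n : ℕ∞) := by
    intro n
    obtain ⟨s, h1, h2, h3⟩ := hlen n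
    rw [← Module.length_compositionSeries s h1 h2, h3]
  obtain ⟨s, h1, h2, -⟩ := hlen 0
  obtain ⟨g, hg, c, B, hcB⟩ := aux_chain hd x J hJ s h1 (Fin.last _)
  have hlast : s (Fin.last _) = ⊤ := h2
  rw [hlast, Submodule.comap_top] at hg
  have hsum : ∀ n, ∑ j ∈ Finset.range (n + 1), g j = len n := by
    intro n
    induction n with
    | zero =>
      have h := hg 0
      have hz : Module.length R (M ⧸ (J ^ 0 • ⊤ : Submodule R M)) = 0 := by
        rw [Module.length_eq_zero_iff, Submodule.Quotient.subsingleton_iff, pow_zero,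
          Submodule.one_smul]
      rw [hL, hz, add_zero] at h
      rw [zero_add, Finset.sum_range_one]
      exact_mod_cast h.symm
    | succ n ih =>
      have h := hg (n + 1)
      rw [hL, hL] at h
      rw [Finset.sum_range_succ, ih, add_comm]
      exact_mod_cast h.symm
  simp_rw [hsum] at hcB
  obtain ⟨D, rfl⟩ := Nat.exists_eq_add_of_le' hd
  have hmc : ∀ n, (D + 1).multichoose n = (n + D).choose D := by
    intro n
    rw [Nat.multichoose_eq, show D + 1 + n - 1 = D + n by omega, ← Nat.choose_symm_add, add_comm]
  have he' : ∀ n ≥ n0, (len n : ℤ) = e 0 * ((n + (D + 1)).choose (D + 1) : ℤ) +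
      ∑ i ∈ Finset.range (D + 1), (-1) ^ (i + 1) * e (i + 1) *
        ((n + (D - i)).choose (D - i) : ℤ) := by
    intro n hn
    rw [he n hn, Finset.sum_range_succ', add_comm]
    congr 1
    · simp
    · refine Finset.sum_congr rfl fun i hi => ?_
      have := Finset.mem_range.1 hi
      rw [show n + (D + 1) - (i + 1) = n + (D - i) by omega,
        show D + 1 - (i + 1) = D - i by omega]
  have hlo : ∀ n, (c : ℤ) * ((n + (D + 1)).choose (D + 1) : ℤ) ≤ len n := fun n => by
    exact_mod_cast (hcB n).1
  have hhi : ∀ n, (len n : ℤ) ≤ (c : ℤ) * ((n + (D + 1)).choose (D + 1) : ℤ) +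
      B * ((n + D).choose D : ℤ) := fun n => by
    rw [← hmc]
    exact_mod_cast (hcB n).2
  have hge : (c : ℤ) ≤ e 0 := by
    have := aux_asym (D + 1) (fun i => if i = 0 then e 0 - c else (-1) ^ i * e i) n0 (by
      intro n hn
      rw [Finset.sum_range_succ']
      simp only [if_true, Nat.add_eq_zero_iff, one_ne_zero, and_false, if_false, Nat.sub_zero,
        Nat.add_sub_add_right]
      have h1 := he' n hn
      have h2 := hlo n
      linarith)
    simp at this
    exact this
  have hle : e 0 ≤ (c : ℤ) := by
    have := aux_asym (D + 1) (fun i => if i = 0 then c - e 0 else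
      -((-1) ^ i * e i) + if i = 1 then (B : ℤ) else 0) n0 (by
      intro n hn
      rw [Finset.sum_range_succ']
      simp only [if_true, Nat.add_eq_zero_iff, one_ne_zero, and_false, if_false, Nat.sub_zero,
        Nat.add_sub_add_right, add_mul, neg_mul, Finset.sum_add_distrib, Finset.sum_neg_distrib]
      have h1 := he' n hn
      have h2 := hhi n
      have h3 : ∑ i ∈ Finset.range (D + 1), (if i + 1 = 1 then (B : ℤ) else 0) *
          ((n + (D - i)).choose (D - i) : ℤ) = B * ((n + D).choose D : ℤ) := by
        rw [Finset.sum_eq_single 0] <;> simp +contextual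
      linarith)
    simp at this
    exact this
  have hec := le_antisymm hle hge
  have := aux_asym D (fun i => (-1) ^ (i + 1) * e (i + 1)) n0 (by
    intro n hn
    have h1 := he' n hn
    have h2 := hlo n
    rw [hec] at h1
    linarith)
  simp at this
  exact this
end

section
/- Let (R,m) be a Noetherian local ring and M a finite R-module with dim M = d and depth M = d − 1. Then for any ideal J generated by a system of parameters for M, e_1(J,M) < 0. -/
section ChernAux
open IsLocalRing

/-- multiples of `a` -/
def aMul {R M : Type*} [CommRing R] [AddCommGroup M] [Module R M] (a : R) : Submodule R M :=
  LinearMap.range (LinearMap.lsmul R M a)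

lemma mem_sup_aMul {R M : Type*} [CommRing R] [AddCommGroup M] [Module R M] (a : R)
    (N : Submodule R M) (z : M) : z ∈ N ⊔ aMul a ↔ ∃ n ∈ N, ∃ w, n + a • w = z := by
  rw [Submodule.mem_sup]
  constructor
  · rintro ⟨n, hn, _, ⟨w, rfl⟩, h⟩
    exact ⟨n, hn, w, h⟩
  · rintro ⟨n, hn, w, h⟩
    exact ⟨n, hn, _, ⟨w, rfl⟩, h⟩

/-- `a` regular on `M/N` -/
def RegMod {R M : Type*} [CommRing R] [AddCommGroup M] [Module R M] (a : R)
    (N : Submodule R M) : Prop := ∀ z, a • z ∈ N → z ∈ N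

/-- `M/N` has depth exactly `d` -/
def DepthEq {R M : Type*} [CommRing R] [IsLocalRing R] [AddCommGroup M] [Module R M] :
    ℕ → Submodule R M → Prop
  | 0, N => ∃ z, z ∉ N ∧ ∀ r ∈ maximalIdeal R, r • z ∈ N
  | d + 1, N => ∃ a ∈ maximalIdeal R, RegMod a N ∧ DepthEq d (N ⊔ aMul a)

lemma RegMod.iff_quot {R M : Type*} [CommRing R] [AddCommGroup M] [Module R M] (a : R)
    (N : Submodule R M) : RegMod a N ↔ IsSMulRegular (M ⧸ N) a :=
  (isSMulRegular_quotient_iff_mem_of_smul_mem N a).symm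

lemma RegMod.swap {R M : Type*} [CommRing R] [AddCommGroup M] [Module R M] {a y : R}
    {N : Submodule R M} (ha : RegMod a N) (hy : RegMod y (N ⊔ aMul a)) :
    RegMod a (N ⊔ aMul y) := by
  intro z hz
  obtain ⟨n, hn, w, hw⟩ := (mem_sup_aMul _ _ _).1 hz
  have : y • w ∈ N ⊔ aMul a := (mem_sup_aMul _ _ _).2
    ⟨-n, N.neg_mem hn, z, by rw [← hw]; abel⟩
  obtain ⟨n', hn', u, hu⟩ := (mem_sup_aMul _ _ _).1 (hy _ this)
  have h2 : a • (z - y • u) ∈ N := by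
    have : a • (z - y • u) = n + y • n' := by
      rw [smul_sub, ← hw, ← hu, smul_add, smul_comm a y u]; abel
    rw [this]
    exact N.add_mem hn (N.smul_mem _ hn')
  exact (mem_sup_aMul _ _ _).2 ⟨_, ha _ h2, u, by abel⟩

lemma exists_regular_of_no_socle {R Q : Type*} [CommRing R] [IsLocalRing R] [IsNoetherianRing R]
    [AddCommGroup Q] [Module R Q] [Module.Finite R Q]
    (h : ∀ z : Q, (∀ r ∈ maximalIdeal R, r • z = 0) → z = 0) :
    ∃ y ∈ maximalIdeal R, IsSMulRegular Q y := by
  by_contra! hcon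
  have h1 : ((maximalIdeal R : Ideal R) : Set R) ⊆ ⋃ p ∈ associatedPrimes R Q, p := by
    rw [biUnion_associatedPrimes_eq_compl_regular]
    exact fun y hy => hcon y hy
  have hfin := associatedPrimes.finite R Q
  have h2 : ∃ p ∈ associatedPrimes R Q, maximalIdeal R ≤ id p := by
    refine (Ideal.subset_union_prime_finite hfin ⊥ ⊥ ?_).1 h1
    intro p hp _ _
    exact hp.1
  · obtain ⟨p, hp, hle⟩ := h2
    obtain ⟨hpp, z, hz⟩ := isAssociatedPrime_iff.1 hp
    have : z = 0 := h z fun r hr => by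
      have := hle hr
      simp only [id, hz, Submodule.mem_colon_singleton] at this
      simpa using this
    apply hpp.ne_top
    rw [hz, this]
    ext; simp

lemma DepthEq.exchange_zero {R M : Type*} [CommRing R] [IsLocalRing R]
    [AddCommGroup M] [Module R M] {N : Submodule R M} {a x : R} (hxm : x ∈ maximalIdeal R)
    (ha : RegMod a N) (hx : RegMod x N)
    (h : DepthEq 0 (N ⊔ aMul a)) : DepthEq 0 (N ⊔ aMul x) := by
  obtain ⟨z, hz, hm⟩ := h
  obtain ⟨n, hn, w, hw⟩ := (mem_sup_aMul _ _ _).1 (hm x hxm)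
  refine ⟨w, fun hc => ?_, fun r hr => ?_⟩
  · obtain ⟨n', hn', u, hu⟩ := (mem_sup_aMul _ _ _).1 hc
    apply hz
    have h2 : x • (z - a • u) ∈ N := by
      have : x • (z - a • u) = n + a • n' := by
        rw [smul_sub, ← hw, ← hu, smul_add, smul_comm a x u]; abel
      rw [this]
      exact N.add_mem hn (N.smul_mem _ hn')
    exact (mem_sup_aMul _ _ _).2 ⟨_, hx _ h2, u, by abel⟩
  · obtain ⟨n', hn', u, hu⟩ := (mem_sup_aMul _ _ _).1 (hm r hr)
    have h2 : a • (r • w - x • u) ∈ N := by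
      have h3 : r • (n + a • w) = x • (n' + a • u) := by rw [hw, hu, smul_comm]
      have : a • (r • w - x • u) = x • n' - r • n := by
        rw [smul_add, smul_add] at h3
        rw [smul_sub, smul_comm a r w, smul_comm a x u, sub_eq_sub_iff_add_eq_add,
          add_comm, h3]
      rw [this]
      exact N.sub_mem (N.smul_mem _ hn') (N.smul_mem _ hn)
    exact (mem_sup_aMul _ _ _).2 ⟨_, ha _ h2, u, by abel⟩

lemma DepthEq.not_zero {R M : Type*} [CommRing R] [IsLocalRing R]
    [AddCommGroup M] [Module R M] {N : Submodule R M} {b : R} (hb : b ∈ maximalIdeal R)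
    (h : RegMod b N) : ¬ DepthEq 0 N := by
  rintro ⟨z, hz, hm⟩
  exact hz (h _ (hm b hb))

lemma DepthEq.exchange {R M : Type*} [CommRing R] [IsLocalRing R] [IsNoetherianRing R]
    [AddCommGroup M] [Module R M] [Module.Finite R M] (d : ℕ) : ∀ {N : Submodule R M} {a x : R}
    (_ : a ∈ maximalIdeal R) (_ : x ∈ maximalIdeal R)
    (_ : RegMod a N) (_ : RegMod x N)
    (_ : DepthEq d (N ⊔ aMul a)), DepthEq d (N ⊔ aMul x) := by
  induction d with
  | zero => intro N a x _ hxm ha hx h; exact h.exchange_zero hxm ha hx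
  | succ d ih =>
    intro N a x ham hxm ha hx h
    obtain ⟨b, hbm, hb, hD⟩ := h
    have n1 := DepthEq.not_zero hbm hb
    have n2 : ¬ DepthEq 0 (N ⊔ aMul x) := fun hc => n1 (hc.exchange_zero ham hx ha)
    have : ∃ y ∈ maximalIdeal R, RegMod y (N ⊔ aMul a) ∧ RegMod y (N ⊔ aMul x) := by
      obtain ⟨y, hym, hy⟩ := exists_regular_of_no_socle (R := R)
        (Q := (M ⧸ (N ⊔ aMul a)) × (M ⧸ (N ⊔ aMul x))) (by
          rintro ⟨z1, z2⟩ hz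
          obtain ⟨z1, rfl⟩ := Submodule.Quotient.mk_surjective _ z1
          obtain ⟨z2, rfl⟩ := Submodule.Quotient.mk_surjective _ z2
          simp only [Prod.smul_mk, Prod.mk_eq_zero, ← Submodule.Quotient.mk_smul,
            Submodule.Quotient.mk_eq_zero] at hz ⊢
          constructor
          · by_contra hc
            exact n1 ⟨z1, hc, fun r hr => (hz r hr).1⟩
          · by_contra hc
            exact n2 ⟨z2, hc, fun r hr => (hz r hr).2⟩)
      rw [isSMulRegular_iff_right_eq_zero_of_smul] at hy
      refine ⟨y, hym, fun z hz => ?_, fun z hz => ?_⟩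
      · have := hy (Submodule.Quotient.mk z, 0) (by
          simp only [Prod.smul_mk, Prod.mk_eq_zero, ← Submodule.Quotient.mk_smul,
            Submodule.Quotient.mk_eq_zero]
          exact ⟨hz, by simp⟩)
        simpa using (Prod.mk_eq_zero.1 this).1
      · have := hy (0, Submodule.Quotient.mk z) (by
          simp only [Prod.smul_mk, Prod.mk_eq_zero, ← Submodule.Quotient.mk_smul,
            Submodule.Quotient.mk_eq_zero]
          exact ⟨by simp, hz⟩)
        simpa using (Prod.mk_eq_zero.1 this).2
    obtain ⟨y, hym, hy1, hy2⟩ := this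
    have e1 := ih hbm hym hb hy1 hD
    rw [sup_right_comm] at e1
    have e2 := ih ham hxm (ha.swap hy1) (hx.swap hy2) e1
    rw [sup_right_comm] at e2
    exact ⟨y, hym, hy2, e2⟩

lemma depthEq_of_list {R M : Type*} [CommRing R] [IsLocalRing R]
    [AddCommGroup M] [Module R M] (ss : List R) : ∀ (rs : List R)
    (_ : RingTheory.Sequence.IsWeaklyRegular M (rs ++ ss)) (_ : ∀ r ∈ ss, r ∈ maximalIdeal R)
    (_ : DepthEq 0 (Ideal.ofList (rs ++ ss) • ⊤ : Submodule R M)),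
    DepthEq ss.length (Ideal.ofList rs • ⊤ : Submodule R M) := by
  induction ss with
  | nil => intro rs _ _ h; simpa using h
  | cons a ss ih =>
    intro rs hreg hm hD
    refine ⟨a, hm a (by simp), ?_, ?_⟩
    · rw [RegMod.iff_quot]
      have := hreg.regular_mod_prev rs.length (by simp)
      have hh : List.take rs.length (rs ++ a :: ss) = rs := List.take_left
      rw [hh] at this
      simpa using this
    · have := ih (rs ++ [a]) (by simpa using hreg) (fun r hr => hm r (by simp [hr]))
        (by simpa using hD)
      convert this using 1
      rw [Ideal.ofList_append, Submodule.sup_smul, Ideal.ofList_singleton]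
      congr 1
      ext z
      simp [aMul, Submodule.ideal_span_singleton_smul, Submodule.mem_smul_pointwise_iff_exists]

lemma depthEq_of_hyp {R M : Type*} [CommRing R] [IsNoetherianRing R]
    [IsLocalRing R] [AddCommGroup M] [Module R M] [Module.Finite R M]
    (d : ℕ) 
    (hdepth₁ : ∃ rs : List R, rs.length = d ∧
      (∀ r ∈ rs, r ∈ IsLocalRing.maximalIdeal R) ∧ RingTheory.Sequence.IsRegular M rs)
    (hdepth₂ : ∀ rs : List R, rs.length = d + 1 →
      (∀ r ∈ rs, r ∈ IsLocalRing.maximalIdeal R) → ¬ RingTheory.Sequence.IsRegular M rs) :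
    DepthEq d (⊥ : Submodule R M) := by
  obtain ⟨rs, hl, hm, hreg⟩ := hdepth₁
  have h0 : DepthEq 0 (Ideal.ofList rs • ⊤ : Submodule R M) := by
    by_contra hc
    obtain ⟨y, hym, hy⟩ := exists_regular_of_no_socle (R := R)
      (Q := M ⧸ (Ideal.ofList rs • ⊤ : Submodule R M)) (by
        intro z hz
        obtain ⟨z, rfl⟩ := Submodule.Quotient.mk_surjective _ z
        simp only [← Submodule.Quotient.mk_smul, Submodule.Quotient.mk_eq_zero] at hz ⊢
        by_contra hc'
        exact hc ⟨z, hc', hz⟩)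
    have hm' : ∀ r ∈ rs ++ [y], r ∈ maximalIdeal R := by
      intro r hr
      rcases List.mem_append.1 hr with h | h
      · exact hm r h
      · simp at h; rwa [h]
    refine hdepth₂ (rs ++ [y]) (by simp [hl]) hm' ?_
    have := hreg.nontrivial
    rw [isRegular_iff_isWeaklyRegular_of_subset_maximalIdeal hm']
    rw [RingTheory.Sequence.isWeaklyRegular_append_iff]
    exact ⟨hreg.toIsWeaklyRegular,
      (RingTheory.Sequence.isWeaklyRegular_singleton_iff _ _).2 hy⟩
  have := depthEq_of_list rs [] (by simpa using hreg.toIsWeaklyRegular) hm (by simpa using h0)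
  simpa [hl] using this
end ChernAux
section ChernAux2
open IsLocalRing TensorProduct

lemma exists_avoid {R E : Type*} [CommRing R] [IsLocalRing R] [Infinite (ResidueField R)]
    [AddCommGroup E] [Module R E] [Module.Finite R E] (S : Set (Submodule R E)) (hS : S.Finite)
    (htop : ∀ L ∈ S, L ≠ ⊤) : ∃ c : E, ∀ L ∈ S, c ∉ L := by
  classical
  have h1 : (⊤ : Submodule (ResidueField R) (ResidueField R ⊗[R] E)) ∉
      hS.toFinset.image (fun L => L.baseChange (ResidueField R)) := by
    intro h
    obtain ⟨L, hL, hLt⟩ := Finset.mem_image.1 h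
    apply htop L (hS.mem_toFinset.1 hL)
    rw [← IsLocalRing.map_tensorProduct_mk_eq_top]
    rw [Submodule.baseChange_eq_span] at hLt
    have := congrArg (Submodule.restrictScalars R) hLt
    rw [Submodule.restrictScalars_span R (ResidueField R) IsLocalRing.residue_surjective,
      Submodule.span_eq] at this
    simpa using this
  have h2 := Subspace.biUnion_ne_univ_of_top_notMem h1
  rw [Ne, Set.eq_univ_iff_forall, not_forall] at h2
  obtain ⟨v, hv⟩ := h2
  obtain ⟨c, rfl⟩ := TensorProduct.mk_surjective R E (ResidueField R)
    IsLocalRing.residue_surjective v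
  refine ⟨c, fun L hL hc => hv ?_⟩
  simp only [Set.mem_iUnion]
  refine ⟨_, Finset.mem_image_of_mem _ (hS.mem_toFinset.2 hL), ?_⟩
  exact Submodule.tmul_mem_baseChange_of_mem _ hc

/-- filtration shifted by one -/
def shiftFilt {R Q : Type*} [CommRing R] [AddCommGroup Q] [Module R Q] (J : Ideal R) :
    J.Filtration Q where
  N n := J ^ (n + 1) • ⊤
  mono n := Submodule.smul_mono_left (Ideal.pow_le_pow_right (by omega))
  smul_le n := by rw [← mul_smul, ← pow_succ']

/-- elements multiplied too deep by `y` -/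
def deepFilt {R Q : Type*} [CommRing R] [AddCommGroup Q] [Module R Q] (J : Ideal R) (y : R)
    (hy : y ∈ J) : J.Filtration Q where
  N n := J ^ n • ⊤ ⊓ (J ^ (n + 2) • ⊤ : Submodule R Q).comap (LinearMap.lsmul R Q y)
  mono n := by
    intro z hz
    have hz1 : z ∈ (J ^ (n + 1) • ⊤ : Submodule R Q) := hz.1
    refine ⟨Submodule.smul_mono_left (Ideal.pow_le_pow_right (by omega)) hz1, ?_⟩
    change y • z ∈ (J ^ (n + 2) • ⊤ : Submodule R Q)
    rw [pow_succ', mul_smul]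
    exact Submodule.smul_mem_smul hy hz1
  smul_le n := by
    rw [Submodule.smul_le]
    intro r hr z hz
    refine ⟨?_, ?_⟩
    · rw [pow_succ', mul_smul]
      exact Submodule.smul_mem_smul hr hz.1
    · change y • r • z ∈ (J ^ (n + 1 + 2) • ⊤ : Submodule R Q)
      rw [smul_comm, show n + 1 + 2 = (n + 2) + 1 by ring, pow_succ', mul_smul]
      exact Submodule.smul_mem_smul hr hz.2

/-- degree one element of the Rees algebra -/
noncomputable def reesOne {R : Type*} [CommRing R] (J : Ideal R) : J →ₗ[R] reesAlgebra J where
  toFun a := ⟨Polynomial.monomial 1 (a : R), by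
    rw [reesAlgebra.monomial_mem]; simp⟩
  map_add' a b := by ext1; simp
  map_smul' r a := by ext1; simp [Polynomial.smul_monomial]

lemma reesOne_pow {R : Type*} [CommRing R] (J : Ideal R) (s : ℕ) : ∀ w ∈ J ^ s,
    ∃ h : Polynomial.monomial s w ∈ reesAlgebra J,
      (⟨Polynomial.monomial s w, h⟩ : reesAlgebra J) ∈ Ideal.span (Set.range (reesOne J)) ^ s := by
  induction s with
  | zero => intro w _; exact ⟨by rw [reesAlgebra.monomial_mem]; simp, by simp⟩
  | succ s ih =>
    intro w hw
    have h : Polynomial.monomial (s + 1) w ∈ reesAlgebra J := by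
      rw [reesAlgebra.monomial_mem]; exact hw
    refine ⟨h, ?_⟩
    rw [pow_succ'] at hw
    suffices H : ∃ h : Polynomial.monomial (s + 1) w ∈ reesAlgebra J,
      (⟨Polynomial.monomial (s + 1) w, h⟩ : reesAlgebra J) ∈
        Ideal.span (Set.range (reesOne J)) ^ (s + 1) from H.2
    clear h
    refine Submodule.mul_induction_on hw ?_ ?_
    · intro a ha b hb
      have h : Polynomial.monomial (s + 1) (a * b) ∈ reesAlgebra J := by
        rw [reesAlgebra.monomial_mem, pow_succ']; exact Ideal.mul_mem_mul ha hb
      refine ⟨h, ?_⟩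
      obtain ⟨h', hmem⟩ := ih b hb
      rw [pow_succ']
      have : (⟨Polynomial.monomial (s + 1) (a * b), h⟩ : reesAlgebra J) =
          reesOne J ⟨a, ha⟩ * ⟨Polynomial.monomial s b, h'⟩ := by
        ext1
        simp [reesOne, Polynomial.monomial_mul_monomial, add_comm]
      rw [this]
      exact Ideal.mul_mem_mul (Ideal.subset_span ⟨_, rfl⟩) hmem
    · rintro a b ⟨ha, ha'⟩ ⟨hb, hb'⟩
      have := Ideal.add_mem _ ha' hb'
      refine ⟨by rw [map_add]; exact Subalgebra.add_mem _ ha hb, ?_⟩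
      convert this using 1
      ext1
      simp


lemma rees_radical {A G : Type*} [CommRing A] [IsNoetherianRing A] [AddCommGroup G] [Module A G]
    [Module.Finite A G] (b : A) (B : Ideal A)
    (h : ∀ P ∈ associatedPrimes A G, b ∈ P → B ≤ P) :
    ∃ s : ℕ, ∀ g : G, b • g = 0 → ∀ c ∈ B ^ s, c • g = 0 := by
  let K := LinearMap.ker (LinearMap.lsmul A G b)
  have hb : b ∈ Module.annihilator A K := by
    rw [Module.mem_annihilator]
    rintro ⟨g, hg⟩
    ext1
    exact hg
  have h1 : B ≤ (Module.annihilator A K).radical := by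
    rw [← Ideal.sInf_minimalPrimes]
    refine le_sInf fun P hP => ?_
    have hP' := Module.associatedPrimes.minimalPrimes_annihilator_subset_associatedPrimes A K hP
    exact h P (associatedPrimes.subset_of_injective K.injective_subtype hP') (hP.1.2 hb)
  obtain ⟨s, hs⟩ := Ideal.exists_pow_le_of_le_radical_of_fg h1 (IsNoetherian.noetherian _)
  refine ⟨s, fun g hg c hc => ?_⟩
  have := Module.mem_annihilator.1 (hs hc) ⟨g, hg⟩
  exact congrArg Subtype.val this

lemma rees_primes {A E : Type*} [CommRing A] [IsNoetherianRing A] [AddCommGroup E] [Module A E]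
    (F F' : Submodule A E) (hF : F.FG) : ∃ S : Set (Ideal A), S.Finite ∧
    ∀ (b : A) (B : Ideal A), (∀ P ∈ S, b ∈ P → B ≤ P) →
    ∃ s : ℕ, ∀ g ∈ F, b • g ∈ F' → ∀ c ∈ B ^ s, c • g ∈ F' := by
  have : Module.Finite A F := Module.Finite.iff_fg.2 hF
  refine ⟨associatedPrimes A (F ⧸ F'.comap F.subtype), associatedPrimes.finite _ _, ?_⟩
  intro b B h
  obtain ⟨s, hs⟩ := rees_radical b B h
  refine ⟨s, fun g hg hb c hc => ?_⟩
  have := hs (Submodule.Quotient.mk ⟨g, hg⟩) (by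
    rw [← Submodule.Quotient.mk_smul, Submodule.Quotient.mk_eq_zero]
    exact hb) c hc
  rw [← Submodule.Quotient.mk_smul, Submodule.Quotient.mk_eq_zero] at this
  exact this

lemma single_mem {R Q : Type*} [CommRing R] [AddCommGroup Q] [Module R Q] {J : Ideal R}
    (F : J.Filtration Q) (n : ℕ) (z : Q) :
    PolynomialModule.single R n z ∈ F.submodule ↔ z ∈ F.N n := by
  constructor
  · intro h
    have := h n
    rwa [PolynomialModule.coeff_single, Finsupp.single_apply, if_pos rfl] at this
  · intro h i
    rw [PolynomialModule.coeff_single, Finsupp.single_apply]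
    split_ifs with hi
    · subst hi; exact h
    · exact Submodule.zero_mem _

lemma smul_single_mem {R Q : Type*} [CommRing R] [AddCommGroup Q] [Module R Q] {J : Ideal R}
    (F : J.Filtration Q) (n : ℕ) (z : Q) (s : ℕ) (w : R)
    (hw : Polynomial.monomial s w ∈ reesAlgebra J) :
    (⟨Polynomial.monomial s w, hw⟩ : reesAlgebra J) • PolynomialModule.single R n z ∈ F.submodule ↔
      w • z ∈ F.N (s + n) := by
  rw [← single_mem, ← PolynomialModule.monomial_smul_single]
  rfl

lemma superficial_aux {R Q : Type*} [CommRing R] [IsNoetherianRing R]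
    [AddCommGroup Q] [Module R Q] [Module.Finite R Q] (J : Ideal R) :
    ∃ S : Set (Ideal (reesAlgebra J)), S.Finite ∧ ∀ (y : J)
    (_ : ∀ P ∈ S, reesOne J y ∈ P → ∀ a, reesOne J a ∈ P),
    ∃ k, ∀ n ≥ k, ∀ z ∈ (J ^ n • ⊤ : Submodule R Q), (y : R) • z ∈ (J ^ (n + 2) • ⊤ : Submodule R Q) →
      z ∈ (J ^ (n + 1) • ⊤ : Submodule R Q) := by
  obtain ⟨S, hS, hmain⟩ := rees_primes (J.stableFiltration (⊤ : Submodule R Q)).submodule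
    (shiftFilt J : J.Filtration Q).submodule
    (((J.stableFiltration (⊤ : Submodule R Q)).submodule_fg_iff_stable
    (fun i => IsNoetherian.noetherian _)).2 (J.stableFiltration_stable ⊤))
  refine ⟨S, hS, fun y hy => ?_⟩
  obtain ⟨s, hs⟩ := hmain (reesOne J y) (Ideal.span (Set.range (reesOne J)))
    (fun P hP h => by rw [Ideal.span_le]; rintro _ ⟨a, rfl⟩; exact hy P hP h a)
  have key : ∀ n, J ^ s • (deepFilt J y y.2 : J.Filtration Q).N n ≤ J ^ (s + n + 1) • ⊤ := by
    intro n
    rw [Submodule.smul_le]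
    intro w hw z hz
    obtain ⟨h, hmem⟩ := reesOne_pow J s w hw
    refine (smul_single_mem (shiftFilt J) n z s w h).1
      (hs _ ((single_mem _ n z).2 hz.1) ?_ _ hmem)
    refine (smul_single_mem (shiftFilt J) n z 1 y (reesOne J y).2).2 ?_
    have := hz.2
    change (y : R) • z ∈ (J ^ (1 + n + 1) • ⊤ : Submodule R Q)
    rw [show 1 + n + 1 = n + 2 by ring]
    exact this
  have hst : (deepFilt J y y.2 : J.Filtration Q).Stable :=
    (J.stableFiltration_stable ⊤).of_le (fun n => inf_le_left)
  obtain ⟨n0, hn0⟩ := hst.exists_pow_smul_eq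
  refine ⟨n0 + s, fun n hn z hz hyz => ?_⟩
  obtain ⟨t, rfl⟩ := Nat.exists_eq_add_of_le hn
  have h1 : z ∈ (deepFilt J y y.2 : J.Filtration Q).N (n0 + (t + s)) := by
    rw [show n0 + (t + s) = n0 + s + t by ring]
    exact ⟨hz, hyz⟩
  rw [hn0, pow_add, mul_smul] at h1
  have h2 := Submodule.smul_mono le_rfl (key n0) h1
  rw [← mul_smul, ← pow_add] at h2
  rwa [show n0 + s + t + 1 = t + (s + n0 + 1) by ring]

end ChernAux2
section ChernAux3
open IsLocalRing

lemma not_le_assoc {R Q : Type*} [CommRing R] [IsLocalRing R] [IsNoetherianRing R]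
    [AddCommGroup Q] [Module R Q] [Module.Finite R Q]
    (h : ∀ z : Q, (∀ r ∈ maximalIdeal R, r • z = 0) → z = 0)
    (J : Ideal R) (hfin : ∀ n, IsArtinian R (Q ⧸ (J ^ n • ⊤ : Submodule R Q)))
    (p : Ideal R) (hp : p ∈ associatedPrimes R Q) : ¬ J ≤ p := by
  intro hJ
  obtain ⟨hpp, z, hz⟩ := isAssociatedPrime_iff.1 hp
  have hmem : ∀ r, r ∈ p ↔ r • z = 0 := fun r => by
    rw [hz, Submodule.mem_colon_singleton]; simp
  have hz0 : z ≠ 0 := by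
    rintro rfl
    exact hpp.ne_top ((Ideal.eq_top_iff_one _).2 ((hmem 1).2 (by simp)))
  apply hz0
  apply h
  intro r hr
  rw [← hmem]
  obtain ⟨k, hk⟩ := Ideal.exists_pow_inf_eq_pow_smul J (Submodule.span R {z})
  have hk1 := hk (k + 1) (by omega)
  let q := (J ^ (k + 1) • ⊤ : Submodule R Q).mkQ z
  have := hfin (k + 1)
  obtain ⟨n, y, hy⟩ := IsArtinian.exists_pow_succ_smul_dvd (R := R) r
    (⟨q, Submodule.mem_span_singleton_self q⟩ : Submodule.span R {q})
  obtain ⟨s, hs⟩ := Submodule.mem_span_singleton.1 y.2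
  have hy' := congrArg Subtype.val hy
  simp only [Submodule.coe_smul, Nat.succ_eq_add_one] at hy'
  rw [← hs] at hy'
  have hu : IsUnit (1 - r * s) := by
    by_contra hc
    have h1 : (1 - r * s) ∈ maximalIdeal R := hc
    have : (1 : R) ∈ maximalIdeal R := by
      have := Ideal.add_mem _ h1 (Ideal.mul_mem_right s _ hr)
      rwa [sub_add_cancel] at this
    exact (maximalIdeal.isMaximal R).ne_top ((Ideal.eq_top_iff_one _).2 this)
  have h2 : (1 - r * s) • (r ^ n • q) = 0 := by
    rw [sub_smul, one_smul, sub_eq_zero, smul_smul,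
      show r * s * r ^ n = r ^ (n + 1) * s by ring, ← smul_smul, hy']
  have h3 : r ^ n • q = 0 := (hu.smul_eq_zero).1 h2
  have h4 : r ^ n • z ∈ (J ^ (k + 1) • ⊤ : Submodule R Q) := by
    rw [← Submodule.Quotient.mk_eq_zero]
    exact h3
  have h5 : r ^ n • z ∈ J ^ (k + 1) • ⊤ ⊓ Submodule.span R {z} :=
    ⟨h4, Submodule.smul_mem _ _ (Submodule.mem_span_singleton_self z)⟩
  rw [hk1, show k + 1 - k = 1 by omega, pow_one] at h5
  have h6 : J • (J ^ k • ⊤ ⊓ Submodule.span R {z}) ≤ (⊥ : Submodule R Q) := by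
    rw [Submodule.smul_le]
    rintro a ha w ⟨-, hw⟩
    obtain ⟨t, rfl⟩ := Submodule.mem_span_singleton.1 hw
    rw [smul_comm, (hmem a).1 (hJ ha), smul_zero]
    exact Submodule.zero_mem _
  exact hpp.mem_of_pow_mem n ((hmem _).2 (h6 h5))

lemma superficial {R Q : Type*} [CommRing R] [IsLocalRing R] [IsNoetherianRing R]
    [Infinite (ResidueField R)]
    [AddCommGroup Q] [Module R Q] [Module.Finite R Q]
    (h : ∀ z : Q, (∀ r ∈ maximalIdeal R, r • z = 0) → z = 0)
    {d : ℕ} (x : Fin (d + 1) → R)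
    (J : Ideal R) (hJ : J = Ideal.span (Set.range x))
    (hfin : ∀ n, IsArtinian R (Q ⧸ (J ^ n • ⊤ : Submodule R Q))) :
    ∃ c : Fin (d + 1) → R, (∃ i0, IsUnit (c i0)) ∧ IsSMulRegular Q (∑ i, c i * x i) ∧
      ∃ n1, ∀ n ≥ n1, ∀ z : Q, (∑ i, c i * x i) • z ∈ (J ^ (n + 1) • ⊤ : Submodule R Q) →
        z ∈ (J ^ n • ⊤ : Submodule R Q) := by
  obtain ⟨S, hS, hmain⟩ := superficial_aux (Q := Q) J
  let φ : (Fin (d + 1) → R) →ₗ[R] R := Fintype.linearCombination R x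
  have hφ : ∀ c, φ c = ∑ i, c i * x i := fun c => by
    simp [φ, Fintype.linearCombination_apply]
  have hrange : LinearMap.range φ = J := by
    rw [hJ]; exact Fintype.range_linearCombination R x
  have hφJ : ∀ c, φ c ∈ J := fun c => hrange ▸ LinearMap.mem_range_self φ c
  let ψ : (Fin (d + 1) → R) →ₗ[R] J := φ.codRestrict J hφJ
  let L0 : Submodule R (Fin (d + 1) → R) := Submodule.pi Set.univ (fun _ => maximalIdeal R)
  let S1 : Set (Submodule R (Fin (d + 1) → R)) :=
    (fun p : Ideal R => Submodule.comap φ p) '' associatedPrimes R Q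
  let S2 : Set (Submodule R (Fin (d + 1) → R)) :=
    (fun P : Ideal (reesAlgebra J) => (P.restrictScalars R).comap (reesOne J ∘ₗ ψ)) ''
      {P ∈ S | ¬ ∀ a, reesOne J a ∈ P}
  obtain ⟨c, hc⟩ := exists_avoid (insert L0 (S1 ∪ S2))
    ((((associatedPrimes.finite R Q).image _).union ((hS.subset (Set.sep_subset _ _)).image _)).insert _)
    (by
      intro L hL
      rcases hL with rfl | hL | hL
      · intro ht
        have : (1 : Fin (d + 1) → R) ∈ L0 := by rw [ht]; trivial
        have := this 0 trivial
        exact (maximalIdeal.isMaximal R).ne_top ((Ideal.eq_top_iff_one _).2 this)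
      · obtain ⟨p, hp, rfl⟩ := hL
        intro ht
        apply not_le_assoc h J hfin p hp
        rw [← hrange, LinearMap.range_le_iff_comap]
        exact ht
      · obtain ⟨P, ⟨hP, hP'⟩, rfl⟩ := hL
        intro ht
        apply hP'
        intro a
        have ha : (a : R) ∈ LinearMap.range φ := hrange ▸ a.2
        obtain ⟨c, hc⟩ := ha
        have h1 : c ∈ (P.restrictScalars R).comap (reesOne J ∘ₗ ψ) := by
          have : c ∈ (⊤ : Submodule R (Fin (d + 1) → R)) := trivial
          rwa [← ht] at this
        have h2 : ψ c = a := Subtype.ext hc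
        have h3 : reesOne J (ψ c) ∈ P := h1
        rwa [h2] at h3)
  refine ⟨c, ?_, ?_, ?_⟩
  · by_contra! hcon
    apply hc L0 (Or.inl rfl)
    intro i _
    exact hcon i
  · rw [← hφ]
    by_contra hcon
    have h1 : φ c ∈ {r : R | IsSMulRegular Q r}ᶜ := hcon
    rw [← biUnion_associatedPrimes_eq_compl_regular] at h1
    simp only [Set.mem_iUnion] at h1
    obtain ⟨p, hp, hcp⟩ := h1
    exact hc _ (Or.inr (Or.inl ⟨p, hp, rfl⟩)) hcp
  have hreg : IsSMulRegular Q (φ c) := by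
    by_contra hcon
    have h1 : φ c ∈ {r : R | IsSMulRegular Q r}ᶜ := hcon
    rw [← biUnion_associatedPrimes_eq_compl_regular] at h1
    simp only [Set.mem_iUnion] at h1
    obtain ⟨p, hp, hcp⟩ := h1
    exact hc _ (Or.inr (Or.inl ⟨p, hp, rfl⟩)) hcp
  rw [← hφ]
  obtain ⟨k, hk⟩ := hmain (ψ c) (fun P hP hyP => by
    by_contra hcon
    exact hc _ (Or.inr (Or.inr ⟨P, ⟨hP, hcon⟩, rfl⟩)) hyP)
  have hk : ∀ n ≥ k, ∀ z ∈ (J ^ n • ⊤ : Submodule R Q), φ c • z ∈ (J ^ (n + 2) • ⊤ : Submodule R Q) →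
      z ∈ (J ^ (n + 1) • ⊤ : Submodule R Q) := hk
  obtain ⟨t, ht⟩ := Ideal.exists_pow_inf_eq_pow_smul J (LinearMap.range (LinearMap.lsmul R Q (φ c)))
  refine ⟨k + t, fun n hn z hz => ?_⟩
  have h0 : z ∈ (J ^ k • ⊤ : Submodule R Q) := by
    have h1 : φ c • z ∈ J ^ (n + 1) • ⊤ ⊓ (LinearMap.range (LinearMap.lsmul R Q (φ c))) :=
      ⟨hz, z, rfl⟩
    rw [ht (n + 1) (by omega)] at h1
    have h2 := Submodule.smul_mono (Ideal.pow_le_pow_right (show k ≤ n + 1 - t by omega))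
      (inf_le_right) h1
    rw [LinearMap.range_eq_map, ← Submodule.map_smul''] at h2
    obtain ⟨w, hw, hwz⟩ := h2
    have : w = z := hreg hwz
    exact this ▸ hw
  have climb : ∀ j, k + j ≤ n → z ∈ (J ^ (k + j) • ⊤ : Submodule R Q) := by
    intro j
    induction j with
    | zero => intro _; exact h0
    | succ j ih =>
      intro hj
      refine hk (k + j) (by omega) z (ih (by omega)) ?_
      exact Submodule.smul_mono_left (Ideal.pow_le_pow_right (by omega)) hz
  have := climb (n - k) (by omega)
  rwa [show k + (n - k) = n by omega] at this

end ChernAux3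
section ChernAux4
open IsLocalRing

lemma length_mul_seq {R M : Type*} [CommRing R] [AddCommGroup M] [Module R M]
    (B : Submodule R M) (b : R) :
    Module.length R (M ⧸ B) = Module.length R (M ⧸ B.comap (LinearMap.lsmul R M b)) +
      Module.length R (M ⧸ (B ⊔ aMul b)) := by
  refine Module.length_eq_add_of_exact
    (Submodule.mapQ (B.comap (LinearMap.lsmul R M b)) B (LinearMap.lsmul R M b) le_rfl)
    (Submodule.factor (le_sup_left : B ≤ B ⊔ aMul b)) ?_ ?_ ?_
  · rw [← LinearMap.ker_eq_bot, Submodule.ker_mapQ]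
    exact Submodule.mkQ_map_self _
  · exact Submodule.factor_surjective _
  · intro z
    obtain ⟨z, rfl⟩ := Submodule.mkQ_surjective _ z
    change (Submodule.Quotient.mk z : M ⧸ (B ⊔ aMul b)) = 0 ↔ _
    rw [Submodule.Quotient.mk_eq_zero, mem_sup_aMul]
    constructor
    · rintro ⟨n, hn, w, rfl⟩
      refine ⟨Submodule.Quotient.mk w, ?_⟩
      rw [Submodule.mapQ_apply, Submodule.mkQ_apply, Submodule.Quotient.eq]
      simpa using hn
    · rintro ⟨w, hw⟩
      obtain ⟨w, rfl⟩ := Submodule.mkQ_surjective _ w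
      rw [Submodule.mkQ_apply, Submodule.mkQ_apply, Submodule.mapQ_apply, Submodule.Quotient.eq] at hw
      exact ⟨_, B.neg_mem hw, w, by simp⟩

lemma length_quot_lt {R M : Type*} [CommRing R] [AddCommGroup M] [Module R M]
    (A C : Submodule R M) (h : A ≤ C) (z : M) (hC : z ∈ C) (hA : z ∉ A)
    (hf : Module.length R (M ⧸ A) ≠ ⊤) :
    Module.length R (M ⧸ C) < Module.length R (M ⧸ A) := by
  have h1 := Module.length_eq_add_of_exact (LinearMap.ker (Submodule.factor h)).subtype
    (Submodule.factor h) (Submodule.injective_subtype _) (Submodule.factor_surjective h)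
    (LinearMap.exact_subtype_ker_map _)
  have : Nontrivial (LinearMap.ker (Submodule.factor h)) := by
    refine ⟨⟨Submodule.Quotient.mk z, ?_⟩, 0, ?_⟩
    · exact (Submodule.Quotient.mk_eq_zero C).2 hC
    · intro h0
      apply hA
      rw [← Submodule.Quotient.mk_eq_zero]
      exact congrArg Subtype.val h0
  have h2 : 0 < Module.length R (LinearMap.ker (Submodule.factor h)) := Module.length_pos
  rw [h1] at hf ⊢
  have hne : Module.length R (M ⧸ C) ≠ ⊤ := fun h => hf (by rw [h, add_top])
  calc Module.length R (M ⧸ C) = 0 + Module.length R (M ⧸ C) := (zero_add _).symm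
    _ < _ := by
      exact (ENat.add_lt_add_iff_right hne).2 h2

lemma comap_pow_quot {R M : Type*} [CommRing R] [AddCommGroup M] [Module R M]
    (N : Submodule R M) (I : Ideal R) :
    (I • ⊤ : Submodule R (M ⧸ N)).comap N.mkQ = I • ⊤ ⊔ N := by
  rw [← Submodule.range_mkQ N, ← Submodule.map_top, ← Submodule.map_smul'',
    Submodule.comap_map_mkQ, sup_comm]

lemma sup_pow_le' {R : Type*} [CommRing R] (J Y : Ideal R) (n : ℕ) :
    (J ⊔ Y) ^ n ≤ J ^ n ⊔ Y := by
  induction n with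
  | zero => simp
  | succ n ih =>
    rw [pow_succ]
    refine (Ideal.mul_mono_left ih).trans ?_
    rw [Ideal.sup_mul, Ideal.mul_sup]
    refine sup_le (sup_le ?_ ?_) ?_
    · rw [← pow_succ]; exact le_sup_left
    · exact le_trans (Ideal.mul_le_right : J ^ n * Y ≤ Y) le_sup_right
    · exact le_trans (Ideal.mul_le_left : Y * (J ⊔ Y) ≤ Y) le_sup_right

lemma reduce_eq {R M : Type*} [CommRing R] [AddCommGroup M] [Module R M]
    (N : Submodule R M) (J J' : Ideal R) (y : R) (h1 : J' ≤ J)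
    (h2 : J ≤ J' ⊔ Ideal.span {y}) (n : ℕ) :
    (J ^ n • ⊤ ⊔ N) ⊔ aMul y = J' ^ n • ⊤ ⊔ (N ⊔ aMul y) := by
  rw [sup_assoc]
  apply le_antisymm
  · refine sup_le ?_ le_sup_right
    refine (Submodule.smul_mono_left ((Ideal.pow_right_mono h2 n).trans (sup_pow_le' _ _ n))).trans ?_
    rw [Submodule.sup_smul]
    refine sup_le le_sup_left (le_trans ?_ (le_sup_right.trans le_sup_right))
    rw [Submodule.smul_le]
    intro r hr z _
    obtain ⟨s, rfl⟩ := Ideal.mem_span_singleton'.1 hr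
    exact ⟨s • z, by simp [smul_smul, mul_comm]⟩
  · exact sup_le_sup_right (Submodule.smul_mono_left (Ideal.pow_right_mono h1 n)) _

lemma main_zero {R M : Type*} [CommRing R] [IsLocalRing R] [IsNoetherianRing R]
    [AddCommGroup M] [Module R M] [Module.Finite R M] (N : Submodule R M) (hN : DepthEq 0 N)
    (x : Fin 1 → R) (hx : ∀ i, x i ∈ maximalIdeal R)
    (J : Ideal R) (hJ : J = Ideal.span (Set.range x))
    (len : ℕ → ℕ) (hlen : ∀ n, Module.length R (M ⧸ (J ^ (n + 1) • ⊤ ⊔ N : Submodule R M)) = len n)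
    (e : ℕ → ℤ) (n0 : ℕ)
    (he : ∀ n ≥ n0, (len n : ℤ) =
      ∑ i ∈ Finset.range (1 + 1), (-1) ^ i * e i * ((n + 1 - i).choose (1 - i) : ℤ)) :
    e 1 < 0 := by
  obtain ⟨z, hz, hzm⟩ := hN
  have hJ1 : J = Ideal.span {x 0} := by rw [hJ, Set.range_unique]; rfl
  have hJtop : J ≠ ⊤ := by
    rw [hJ1]
    intro h
    rw [Ideal.span_singleton_eq_top] at h
    exact (mem_maximalIdeal _).1 (hx 0) h
  have hkrull := Ideal.iInf_pow_smul_eq_bot_of_isLocalRing (M := M ⧸ N) J hJtop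
  have hex : ∃ i : ℕ, z ∉ (J ^ i • ⊤ ⊔ N : Submodule R M) := by
    by_contra! hcon
    apply hz
    rw [← Submodule.Quotient.mk_eq_zero, ← Submodule.mem_bot R, ← hkrull, Submodule.mem_iInf]
    intro i
    have := hcon i
    rw [← comap_pow_quot] at this
    exact this
  obtain ⟨i, hi⟩ := hex
  have hr : z ∉ (J ^ (i + n0 + 1) • ⊤ ⊔ N : Submodule R M) := fun h => hi
    ((sup_le_sup_right (Submodule.smul_mono_left (Ideal.pow_le_pow_right (by omega))) N :
      (J ^ (i + n0 + 1) • ⊤ ⊔ N : Submodule R M) ≤ J ^ i • ⊤ ⊔ N) h)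
  have hseq := length_mul_seq (J ^ ((n0 + (i + n0 + 1)) + 1) • ⊤ ⊔ N : Submodule R M) (x 0 ^ (n0 + 1))
  have hpow : x 0 ^ (n0 + 1) ∈ J ^ (n0 + 1) := Ideal.pow_mem_pow (by
    rw [hJ1]; exact Ideal.mem_span_singleton_self _) _
  have h1 : (J ^ ((n0 + (i + n0 + 1)) + 1) • ⊤ ⊔ N : Submodule R M) ⊔ aMul (x 0 ^ (n0 + 1)) =
      J ^ (n0 + 1) • ⊤ ⊔ N := by
    apply le_antisymm
    · refine sup_le (sup_le_sup_right (Submodule.smul_mono_left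
        (Ideal.pow_le_pow_right (by omega))) _) (le_trans ?_ le_sup_left)
      rintro _ ⟨w, rfl⟩
      exact Submodule.smul_mem_smul hpow trivial
    · refine sup_le (le_trans ?_ le_sup_right) (le_sup_right.trans le_sup_left)
      rw [hJ1, Ideal.span_singleton_pow, Submodule.smul_le]
      intro r hr w _
      obtain ⟨s, rfl⟩ := Ideal.mem_span_singleton'.1 hr
      exact ⟨s • w, by simp [smul_smul, mul_comm]⟩
  have h2 : (J ^ (i + n0 + 1) • ⊤ ⊔ N : Submodule R M) ≤
      (J ^ ((n0 + (i + n0 + 1)) + 1) • ⊤ ⊔ N : Submodule R M).comap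
        (LinearMap.lsmul R M (x 0 ^ (n0 + 1))) := by
    refine sup_le ?_ ?_
    · rw [← Submodule.map_le_iff_le_comap, Submodule.map_smul'']
      rw [show n0 + (i + n0 + 1) + 1 = (i + n0 + 1) + (n0 + 1) by ring, pow_add _ (i + n0 + 1),
        mul_smul]
      refine le_trans (Submodule.smul_mono le_rfl ?_) le_sup_left
      rintro _ ⟨w, -, rfl⟩
      exact Submodule.smul_mem_smul hpow trivial
    · intro w hw
      exact (le_sup_right : N ≤ _) (N.smul_mem _ hw)
  have h3 : z ∈ (J ^ ((n0 + (i + n0 + 1)) + 1) • ⊤ ⊔ N : Submodule R M).comap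
        (LinearMap.lsmul R M (x 0 ^ (n0 + 1))) := by
    refine (le_sup_right : N ≤ _) (hzm _ ?_)
    exact Ideal.pow_mem_of_mem _ (hx 0) _ (by omega)
  have h4 := length_quot_lt _ _ h2 z h3 hr (by rw [hlen]; exact ENat.natCast_ne_top _)
  rw [h1, hlen, hlen] at hseq
  rw [hlen] at h4
  obtain ⟨c, hc⟩ := ENat.ne_top_iff_exists.1 h4.ne_top
  rw [← hc] at hseq h4
  norm_cast at hseq h4
  have e1 := he n0 (by omega)
  have e2 := he (i + n0) (by omega)
  have e3 := he (n0 + (i + n0 + 1)) (by omega)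
  simp only [Finset.sum_range_succ, Finset.sum_range_zero] at e1 e2 e3
  norm_num at e1 e2 e3
  have h5 : (len (n0 + (i + n0 + 1)) : ℤ) < len (i + n0) + len n0 := by
    exact_mod_cast (by omega)
  rw [e1, e2, e3] at h5
  nlinarith

lemma main_inf {R M : Type*} [CommRing R] [IsLocalRing R] [IsNoetherianRing R]
    [Infinite (ResidueField R)]
    [AddCommGroup M] [Module R M] [Module.Finite R M] (d : ℕ) :
    ∀ (N : Submodule R M) (_ : DepthEq d N)
    (x : Fin (d + 1) → R) (_ : ∀ i, x i ∈ maximalIdeal R)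
    (J : Ideal R) (_ : J = Ideal.span (Set.range x))
    (len : ℕ → ℕ)
    (_ : ∀ n, Module.length R (M ⧸ (J ^ (n + 1) • ⊤ ⊔ N : Submodule R M)) = len n)
    (e : ℕ → ℤ) (n0 : ℕ)
    (_ : ∀ n ≥ n0, (len n : ℤ) =
      ∑ i ∈ Finset.range (d + 1 + 1), (-1) ^ i * e i * ((n + (d + 1) - i).choose (d + 1 - i) : ℤ)),
    e 1 < 0 := by
  induction d with
  | zero => exact fun N hN x hx J hJ len hlen e n0 he => main_zero N hN x hx J hJ len hlen e n0 he
  | succ d ih =>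
    intro N hN x hx J hJ len hlen e n0 he
    obtain ⟨a, ham, ha, hd⟩ := hN
    have hns : ∀ z : M ⧸ N, (∀ r ∈ maximalIdeal R, r • z = 0) → z = 0 := by
      intro z hz
      exact ((RegMod.iff_quot a N).1 ha) (by simp [hz a ham])
    have hfin : ∀ n, IsArtinian R ((M ⧸ N) ⧸ (J ^ n • ⊤ : Submodule R (M ⧸ N))) := by
      intro n
      have h1 : IsFiniteLength R (M ⧸ (J ^ (n + 1) • ⊤ ⊔ N : Submodule R M)) := by
        rw [← Module.length_ne_top_iff, hlen]; exact ENat.natCast_ne_top _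
      have := (isFiniteLength_iff_isNoetherian_isArtinian.1 h1).2
      refine isArtinian_of_surjective _ (Submodule.mapQ (J ^ (n + 1) • ⊤ ⊔ N : Submodule R M)
        (J ^ n • ⊤ : Submodule R (M ⧸ N)) N.mkQ ?_) ?_
      · rw [comap_pow_quot]
        exact sup_le_sup_right (Submodule.smul_mono_left (Ideal.pow_le_pow_right (by omega))) _
      · intro q
        obtain ⟨q, rfl⟩ := Submodule.mkQ_surjective _ q
        obtain ⟨q, rfl⟩ := Submodule.mkQ_surjective _ q
        exact ⟨Submodule.Quotient.mk q, rfl⟩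
    obtain ⟨c, ⟨i0, hi0⟩, hreg, n1, hn1⟩ := superficial hns x J hJ hfin
    set y := ∑ i, c i * x i with hy
    have hym : y ∈ maximalIdeal R := Ideal.sum_mem _ fun i _ => Ideal.mul_mem_left _ _ (hx i)
    have hyJ : y ∈ J := by
      rw [hJ]
      exact Ideal.sum_mem _ fun i _ => Ideal.mul_mem_left _ _ (Ideal.subset_span ⟨i, rfl⟩)
    have hyN : RegMod y N := (RegMod.iff_quot y N).2 hreg
    have hd' := DepthEq.exchange d ham hym ha hyN hd
    let J' := Ideal.span (Set.range (x ∘ i0.succAbove))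
    have hJ1 : J' ≤ J := by
      rw [hJ]; exact Ideal.span_mono (Set.range_comp_subset_range _ _)
    have hJ2 : J ≤ J' ⊔ Ideal.span {y} := by
      rw [hJ, Ideal.span_le]
      have hs : ∀ j, x (i0.succAbove j) ∈ J' := fun j => Ideal.subset_span ⟨j, rfl⟩
      rintro _ ⟨i, rfl⟩
      rcases Fin.eq_self_or_eq_succAbove i0 i with rfl | ⟨j, rfl⟩
      · have h1 : c i * x i = y - ∑ j, c (i.succAbove j) * x (i.succAbove j) := by
          rw [hy, Fin.sum_univ_succAbove _ i]; ring
        have h2 : c i * x i ∈ J' ⊔ Ideal.span {y} := by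
          rw [h1]
          refine Ideal.sub_mem _ (Ideal.mem_sup_right (Ideal.mem_span_singleton_self y))
            (Ideal.mem_sup_left (Ideal.sum_mem _ fun j _ => Ideal.mul_mem_left _ _ (hs j)))
        exact (Ideal.unit_mul_mem_iff_mem _ hi0).1 h2
      · exact Ideal.mem_sup_left (hs j)
    have hred := fun n => reduce_eq N J J' y hJ1 hJ2 n
    have hfl : ∀ n, Module.length R (M ⧸ (J' ^ (n + 1) • ⊤ ⊔ (N ⊔ aMul y) : Submodule R M)) ≠ ⊤ := by
      intro n h
      have h1 := length_mul_seq (J ^ (n + 1) • ⊤ ⊔ N : Submodule R M) y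
      rw [hred, h, add_top, hlen] at h1
      exact ENat.natCast_ne_top _ h1
    choose len' hlen' using fun n => ENat.ne_top_iff_exists.1 (hfl n)
    have hstep : ∀ n ≥ n1, len (n + 1) = len n + len' (n + 1) := by
      intro n hn
      have h1 := length_mul_seq (J ^ (n + 1 + 1) • ⊤ ⊔ N : Submodule R M) y
      have h2 : (J ^ (n + 1 + 1) • ⊤ ⊔ N : Submodule R M).comap (LinearMap.lsmul R M y) =
          J ^ (n + 1) • ⊤ ⊔ N := by
        apply le_antisymm
        · intro z hz
          rw [← comap_pow_quot]
          refine hn1 (n + 1) (by omega) _ ?_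
          rw [← comap_pow_quot] at hz
          exact hz
        · refine sup_le ?_ ?_
          · rw [← Submodule.map_le_iff_le_comap, Submodule.map_smul'']
            rw [pow_succ _ (n + 1), mul_smul]
            refine le_trans (Submodule.smul_mono le_rfl ?_) le_sup_left
            rintro _ ⟨w, -, rfl⟩
            exact Submodule.smul_mem_smul hyJ trivial
          · intro w hw
            exact (le_sup_right : N ≤ _) (N.smul_mem _ hw)
      rw [h2, hred, hlen, hlen, ← hlen'] at h1
      exact_mod_cast h1
    refine ih (N ⊔ aMul y) hd' (x ∘ i0.succAbove) (fun i => hx _) J' rfl len'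
      (fun n => (hlen' n).symm) e (n0 + n1 + 1) ?_
    intro n hn
    obtain ⟨n, rfl⟩ : ∃ k, n = k + 1 := ⟨n - 1, by omega⟩
    have h1 : (len' (n + 1) : ℤ) = len (n + 1) - len n := by
      rw [hstep n (by omega)]; push_cast; ring
    rw [h1, he (n + 1) (by omega), he n (by omega), ← Finset.sum_sub_distrib,
      Finset.sum_range_succ]
    rw [show ∀ a b : ℤ, b = 0 → a + b = a by intros; omega]
    · refine Finset.sum_congr rfl fun i hi => ?_
      have hi := Finset.mem_range.1 hi
      obtain ⟨k, hk⟩ : ∃ k, d + 1 - i = k := ⟨_, rfl⟩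
      rw [show d + 1 + 1 - i = k + 1 by omega, show n + 1 + (d + 1 + 1) - i = (n + k + 1) + 1 by omega,
        show n + (d + 1 + 1) - i = n + k + 1 by omega, hk,
        show n + 1 + (d + 1) - i = n + k + 1 by omega, Nat.choose_succ_succ]
      push_cast
      ring
    · simp

end ChernAux4
section ChernAux5
open IsLocalRing TensorProduct

lemma mem_baseChange_iff {R M S : Type*} [CommRing R] [CommRing S] [Algebra R S]
    [AddCommGroup M] [Module R M] (N : Submodule R M) (v : S ⊗[R] M) :
    v ∈ N.baseChange S ↔ N.mkQ.lTensor S v = 0 := by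
  have h := lTensor_exact S (LinearMap.exact_subtype_mkQ N) N.mkQ_surjective
  exact (h v).symm

lemma regMod_baseChange {R M S : Type*} [CommRing R] [CommRing S] [Algebra R S] [Module.Flat R S]
    [AddCommGroup M] [Module R M] (N : Submodule R M) (a : R) (h : RegMod a N) :
    RegMod (algebraMap R S a) (N.baseChange S) := by
  intro v hv
  rw [mem_baseChange_iff] at hv ⊢
  rw [algebraMap_smul, map_smul] at hv
  have hr := IsSMulRegular.lTensor S ((RegMod.iff_quot a N).1 h)
  exact hr (by simpa using hv)

lemma baseChange_sup_aMul {R M S : Type*} [CommRing R] [CommRing S] [Algebra R S]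
    [AddCommGroup M] [Module R M] (N : Submodule R M) (a : R) :
    (N ⊔ aMul a).baseChange S = N.baseChange S ⊔ aMul (algebraMap R S a) := by
  apply le_antisymm
  · rw [Submodule.baseChange_eq_span, Submodule.span_le]
    rintro _ ⟨z, hz, rfl⟩
    obtain ⟨n, hn, w, rfl⟩ := (mem_sup_aMul _ _ _).1 hz
    refine (mem_sup_aMul _ _ _).2 ⟨1 ⊗ₜ n, Submodule.tmul_mem_baseChange_of_mem 1 hn, 1 ⊗ₜ w, ?_⟩
    rw [algebraMap_smul, TensorProduct.mk_apply, tmul_add, tmul_smul]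
  · refine sup_le (Submodule.baseChange_mono _ le_sup_left) ?_
    rintro _ ⟨v, rfl⟩
    rw [LinearMap.lsmul_apply, algebraMap_smul]
    induction v with
    | zero => simp
    | tmul s w =>
      rw [← tmul_smul]
      exact Submodule.tmul_mem_baseChange_of_mem s ((le_sup_right : aMul a ≤ N ⊔ aMul a) ⟨w, rfl⟩)
    | add v w hv hw => rw [smul_add]; exact Submodule.add_mem _ hv hw

lemma depthEq_baseChange {R M S : Type*} [CommRing R] [CommRing S] [IsLocalRing R] [IsLocalRing S]
    [Algebra R S] [Module.FaithfullyFlat R S] [AddCommGroup M] [Module R M]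
    (hmax : (maximalIdeal R).map (algebraMap R S) = maximalIdeal S) (d : ℕ) :
    ∀ (N : Submodule R M), DepthEq d N → DepthEq d (N.baseChange S) := by
  induction d with
  | zero =>
    rintro N ⟨z, hz, hzm⟩
    refine ⟨1 ⊗ₜ z, fun h => hz ?_, ?_⟩
    · rw [mem_baseChange_iff, LinearMap.lTensor_tmul] at h
      have := Module.FaithfullyFlat.tensorProduct_mk_injective (A := R) (B := S) (M ⧸ N)
        (a₁ := N.mkQ z) (a₂ := 0) (by simpa using h)
      exact (Submodule.Quotient.mk_eq_zero N).1 this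
    · rw [← hmax]
      have : (maximalIdeal R).map (algebraMap R S) ≤
          (N.baseChange S).comap (LinearMap.toSpanSingleton S (S ⊗[R] M) (1 ⊗ₜ z)) := by
        refine Ideal.map_le_iff_le_comap.2 ?_
        intro r hr
        change algebraMap R S r • (1 ⊗ₜ z) ∈ N.baseChange S
        rw [algebraMap_smul, ← tmul_smul]
        exact Submodule.tmul_mem_baseChange_of_mem 1 (hzm r hr)
      exact fun r hr => this hr
  | succ d ih =>
    rintro N ⟨a, ham, ha, hd⟩
    refine ⟨algebraMap R S a, ?_, regMod_baseChange N a ha, ?_⟩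
    · rw [← hmax]; exact Ideal.mem_map_of_mem _ ham
    · rw [← baseChange_sup_aMul]; exact ih _ hd

lemma main_of_ext {R M S : Type*} [CommRing R] [CommRing S] [IsLocalRing R] [IsLocalRing S]
    [IsNoetherianRing S] [Infinite (ResidueField S)]
    [Algebra R S] [Module.FaithfullyFlat R S] [AddCommGroup M] [Module R M] [Module.Finite R M]
    (hmax : (maximalIdeal R).map (algebraMap R S) = maximalIdeal S) (d : ℕ)
    (hd : DepthEq d (⊥ : Submodule R M))
    (x : Fin (d + 1) → R) (hx : ∀ i, x i ∈ maximalIdeal R)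
    (J : Ideal R) (hJ : J = Ideal.span (Set.range x))
    (len : ℕ → ℕ)
    (hlen : ∀ n, Module.length R (M ⧸ (J ^ (n + 1) • ⊤ : Submodule R M)) = len n)
    (e : ℕ → ℤ) (n0 : ℕ)
    (he : ∀ n ≥ n0, (len n : ℤ) =
      ∑ i ∈ Finset.range (d + 1 + 1), (-1) ^ i * e i * ((n + (d + 1) - i).choose (d + 1 - i) : ℤ)) :
    e 1 < 0 := by
  have hd' := depthEq_baseChange (S := S) hmax d _ hd
  rw [Submodule.baseChange_bot] at hd'
  refine main_inf d ⊥ hd' (algebraMap R S ∘ x)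
    (fun i => by rw [← hmax]; exact Ideal.mem_map_of_mem _ (hx i))
    (J.map (algebraMap R S)) (by rw [hJ, Ideal.map_span, Set.range_comp]) len (fun n => ?_) e n0 he
  rw [sup_bot_eq, ← Ideal.map_pow,
    (TensorProduct.tensorQuotMapSMulEquivTensorQuot M S (J ^ (n + 1))).length_eq,
    IsLocalRing.length_baseChange R S, hmax, hlen]
  have : Module.length S (S ⧸ maximalIdeal S) = 1 := by
    rw [Module.length_eq_one_iff]
    exact isSimpleModule_iff_isCoatom.2 (maximalIdeal.isMaximal S).out
  rw [this, mul_one]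

/-- the extension `R(X)` -/
abbrev RX (R : Type*) [CommRing R] [IsLocalRing R] :=
  Localization.AtPrime ((maximalIdeal R).map (Polynomial.C : R →+* Polynomial R))

lemma RX_max (R : Type*) [CommRing R] [IsLocalRing R] :
    (maximalIdeal R).map (algebraMap R (RX R)) = maximalIdeal (RX R) := by
  rw [← Localization.AtPrime.map_eq_maximalIdeal, Ideal.map_map]
  rfl

lemma RX_flat (R : Type*) [CommRing R] [IsLocalRing R] : Module.FaithfullyFlat R (RX R) := by
  have : Module.Flat R (RX R) := Module.Flat.trans R (Polynomial R) (RX R)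
  have : IsLocalHom (algebraMap R (RX R)) := by
    refine ((IsLocalRing.local_hom_TFAE (algebraMap R (RX R))).out 2 0).1 ?_
    exact (RX_max R).le
  exact Module.FaithfullyFlat.of_flat_of_isLocalHom

lemma RX_inf (R : Type*) [CommRing R] [IsLocalRing R] : Infinite (ResidueField (RX R)) := by
  refine Infinite.of_injective (fun i : ℕ => residue (RX R)
    (algebraMap (Polynomial R) (RX R) (Polynomial.X ^ i))) ?_
  intro i j hij
  by_contra hne
  have h1 : algebraMap (Polynomial R) (RX R) (Polynomial.X ^ i - Polynomial.X ^ j) ∈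
      maximalIdeal (RX R) := by
    rw [← residue_eq_zero_iff, map_sub, map_sub, sub_eq_zero]
    exact hij
  rw [IsLocalization.AtPrime.to_map_mem_maximal_iff (RX R)
    ((maximalIdeal R).map (Polynomial.C : R →+* Polynomial R)), Ideal.mem_map_C_iff] at h1
  have h2 := h1 i
  rw [Polynomial.coeff_sub, Polynomial.coeff_X_pow, Polynomial.coeff_X_pow, if_pos rfl,
    if_neg hne, sub_zero] at h2
  exact (maximalIdeal.isMaximal R).ne_top ((Ideal.eq_top_iff_one _).2 h2)

end ChernAux5
/-- Let `(R, m)` be a Noetherian local ring and `M` a finite `R`-module with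
`dim M = d` and `depth M = d − 1` (there is an `M`-regular sequence in `m` of length `d − 1`
but none of length `d`).  Then for any ideal `J` generated by a system of parameters for `M`,
the Chern number satisfies `e₁(J, M) < 0`, where the Hilbert coefficients `e i = eᵢ(J, M)`
satisfy `λ(M/J^(n+1)M) = ∑ᵢ (−1)ⁱ eᵢ(J,M) · C(n + d − i, d − i)` for all `n ≫ 0`. -/
theorem chern_number_neg_of_depth {R M : Type*} [CommRing R] [IsNoetherianRing R]
    [IsLocalRing R] [AddCommGroup M] [Module R M] [Module.Finite R M]
    (d : ℕ) (hd : 1 ≤ d) (hdim : ringKrullDim (R ⧸ Module.annihilator R M) = d)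
    (hdepth₁ : ∃ rs : List R, rs.length = d - 1 ∧
      (∀ r ∈ rs, r ∈ IsLocalRing.maximalIdeal R) ∧ RingTheory.Sequence.IsRegular M rs)
    (hdepth₂ : ∀ rs : List R, rs.length = d →
      (∀ r ∈ rs, r ∈ IsLocalRing.maximalIdeal R) → ¬ RingTheory.Sequence.IsRegular M rs)
    (x : Fin d → R) (hx : ∀ i, x i ∈ IsLocalRing.maximalIdeal R)
    (J : Ideal R) (hJ : J = Ideal.span (Set.range x))
    (len : ℕ → ℕ) (hlen : ∀ n, HasLength R (M ⧸ (J ^ (n + 1) • ⊤ : Submodule R M)) (len n))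
    (e : ℕ → ℤ) (n0 : ℕ)
    (he : ∀ n ≥ n0, (len n : ℤ) =
      ∑ i ∈ Finset.range (d + 1), (-1) ^ i * e i * ((n + d - i).choose (d - i) : ℤ)) :
    e 1 < 0 := by
  obtain ⟨d, rfl⟩ : ∃ k, d = k + 1 := ⟨d - 1, by omega⟩
  have hD := depthEq_of_hyp (M := M) d (by simpa using hdepth₁) hdepth₂
  have := RX_flat R
  have := RX_inf R
  have : IsNoetherianRing (RX R) := IsLocalization.isNoetherianRing
    ((IsLocalRing.maximalIdeal R).map (Polynomial.C : R →+* Polynomial R)).primeCompl _ inferInstance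
  refine main_of_ext (S := RX R) (M := M) (RX_max R) d hD x hx J hJ len (fun n => ?_) e n0 he
  obtain ⟨s, h1, h2, h3⟩ := hlen n
  rw [← Module.length_compositionSeries s h1 h2, h3]
end
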